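/- arXiv:2305.15633 — 2 statements merged into one kernel-verified Lean document; each statement's English description precedes it below -/
import Mathlib

section
/- (Truncated Morawetz estimate) Let d ≥ 4, let χ ∈ C_0^∞(ℝ^d) satisfy 0 ≤ χ ≤ 1, χ(x) = 1 for |x| ≤ 1, and χ(x) = 0 for |x| ≥ 2, and let δ > 0. Let u be a radial classical solution of the defocusing conformal nonlinear wave equation on [0, T] × ℝ^d for some T > 0. Then there is a constant C depending only on d, δ, and χ such that ∫_0^T ∫ χ(x/(δT)) [ u²/|x|³ + |u|^{2(d+1)/(d−1)}/|x| ] dx dt ≤ C ( sup_{t ∈ [0, T]} ‖∇_{t,x} u(t)‖_{L²(|x| ≤ 2δT)}² + sup_{t ∈ [0, T]} (δT)^{−2} ‖u(t)‖_{L²(|x| ≤ 2δT)}² ), where ‖∇_{t,x} u(t)‖² = ‖∇u(t)‖² + ‖∂_t u(t)‖². -/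
noncomputable section

open MeasureTheory Real Set
open scoped ENNReal RealInnerProductSpace

/-- Euclidean space `ℝ^d`. -/
abbrev Euc (d : ℕ) := EuclideanSpace ℝ (Fin d)

/-- The time derivative `∂ₜ u` of a function `u : ℝ × ℝ^d → ℝ` (in curried form). -/
def timeDeriv (d : ℕ) (u : ℝ → Euc d → ℝ) (t : ℝ) (x : Euc d) : ℝ :=
  deriv (fun s => u s x) t

/-- The second time derivative `∂ₜ² u`. -/
def timeDeriv2 (d : ℕ) (u : ℝ → Euc d → ℝ) (t : ℝ) (x : Euc d) : ℝ :=
  deriv (deriv (fun s => u s x)) t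

/-- The spatial Laplacian `Δf = ∑ⱼ ∂²f/∂xⱼ²`. -/
def spatialLap (d : ℕ) (f : Euc d → ℝ) (x : Euc d) : ℝ :=
  ∑ i : Fin d,
    fderiv ℝ (fun y => fderiv ℝ f y (EuclideanSpace.single i 1)) x (EuclideanSpace.single i 1)

/-- A function on `ℝ^d` is radial if it depends only on `|x|`. -/
def IsRadial (d : ℕ) (f : Euc d → ℝ) : Prop := ∃ g : ℝ → ℝ, ∀ x, f x = g ‖x‖

/-- A classical solution of the defocusing conformal nonlinear wave equation
`∂ₜ²u − Δu + |u|^{4/(d−1)} u = 0`: a smooth function satisfying the equation pointwise,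
whose time slices `u(t, ⬝)` and `∂ₜu(t, ⬝)` are (smooth and) compactly supported. -/
def IsClassicalSolution (d : ℕ) (u : ℝ → Euc d → ℝ) : Prop :=
  ContDiff ℝ (⊤ : ℕ∞) (Function.uncurry u) ∧
  (∀ t, HasCompactSupport (u t)) ∧
  (∀ t, HasCompactSupport (fun x => timeDeriv d u t x)) ∧
  (∀ t x, timeDeriv2 d u t x - spatialLap d (u t) x
      + |u t x| ^ ((4 : ℝ) / ((d : ℝ) - 1)) * u t x = 0)

/-- The homogeneous Sobolev norm `‖f‖_{Ḣ^s} = (∫ |ξ|^{2s} |f̂(ξ)|² dξ)^{1/2}`,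
valued in `[0, ∞]`. -/
def sobolevNorm (d : ℕ) (s : ℝ) (f : Euc d → ℝ) : ℝ≥0∞ :=
  (∫⁻ ξ : Euc d,
    ENNReal.ofReal (‖ξ‖ ^ (2 * s) * ‖FourierTransform.fourier (fun x => (f x : ℂ)) ξ‖ ^ 2)) ^
    ((1 : ℝ) / 2)

/-- The space-time Lebesgue norm `‖u‖_{L^r_{t,x}(ℝ × ℝ^d)}`, valued in `[0, ∞]`. -/
def spacetimeNorm (d : ℕ) (r : ℝ≥0∞) (u : ℝ → Euc d → ℝ) : ℝ≥0∞ :=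
  eLpNorm (Function.uncurry u) r volume

/-- The radial Morawetz flux. -/
def morawetzFlux (m : ℕ) (q : ℝ) (v w z : ℝ → ℝ) (r : ℝ) : ℝ :=
  r ^ (m + 3) * ((w r ^ 2 + z r ^ 2) / 2 - |v r| ^ q / q)
    + ((m : ℝ) + 3) / 2 * (r ^ (m + 2) * (v r * w r))
    + ((m : ℝ) + 3) / 4 * (r ^ (m + 1) * v r ^ 2)

/-- The radial Morawetz density. -/
def morawetzBulk (m : ℕ) (q : ℝ) (v : ℝ → ℝ) (r : ℝ) : ℝ :=
  2 / q * (r ^ (m + 2) * |v r| ^ q) + ((m : ℝ) + 3) * (m + 1) / 4 * (r ^ m * v r ^ 2)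

/-- The time derivative of the radial Morawetz action density. -/
def morawetzActionDeriv (m : ℕ) (v w z y x : ℝ → ℝ) (r : ℝ) : ℝ :=
  r ^ (m + 3) * (y r * w r + z r * x r) +
    ((m : ℝ) + 3) / 2 * (r ^ (m + 2) * (y r * v r + z r ^ 2))

lemma hasDerivAt_abs_rpow_comp {v : ℝ → ℝ} {v' r q : ℝ} (hq : 1 < q) (hv : HasDerivAt v v' r) :
    HasDerivAt (fun s => |v s| ^ q) (q * |v r| ^ (q - 2) * v r * v') r :=
  (hasDerivAt_abs_rpow (v r) hq).comp r hv

lemma hasDerivAt_morawetzFlux {m : ℕ} {q : ℝ} (hq : (q - 2) * (m + 3) = 4) {v w z y x w' : ℝ → ℝ}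
    {r : ℝ} (hr : 0 < r)
    (hv : HasDerivAt v (w r) r) (hw : HasDerivAt w (w' r) r) (hz : HasDerivAt z (x r) r)
    (heq : y r - (w' r + ((m : ℝ) + 3) / r * w r) + |v r| ^ (q - 2) * v r = 0) :
    HasDerivAt (morawetzFlux m q v w z)
      (morawetzActionDeriv m v w z y x r + morawetzBulk m q v r) r := by
  have hm : (0 : ℝ) < m + 3 := by positivity
  have hq2 : 2 < q := by
    by_contra! h
    nlinarith [mul_nonneg (sub_nonneg.2 h) hm.le]
  have habs : |v r| ^ q = |v r| ^ (q - 2) * v r ^ 2 := by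
    rw [← sq_abs (v r), ← Real.rpow_natCast |v r| 2, ← Real.rpow_add_of_nonneg (abs_nonneg _)]
    · norm_num
    · linarith
    · norm_num
  have h1 := ((hasDerivAt_pow (m + 3) r).mul ((((hw.pow 2).add (hz.pow 2)).div_const 2).sub
    ((hasDerivAt_abs_rpow_comp (by linarith : 1 < q) hv).div_const q)))
  have h2 := ((hasDerivAt_pow (m + 2) r).mul (hv.mul hw)).const_mul (((m : ℝ) + 3) / 2)
  have h3 := ((hasDerivAt_pow (m + 1) r).mul (hv.pow 2)).const_mul (((m : ℝ) + 3) / 4)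
  refine ((h1.add h2).add h3).congr_deriv ?_
  have hy : y r = (w' r + ((m : ℝ) + 3) / r * w r) - |v r| ^ (q - 2) * v r := by linarith
  have hq0 : q ≠ 0 := by linarith
  have hqq : q = 2 + 4 / (m + 3) := by field_simp; linarith
  simp only [morawetzActionDeriv, morawetzBulk, Pi.pow_apply, Pi.add_apply, Pi.mul_apply,
    Pi.sub_apply, habs, hy]
  generalize |v r| ^ (q - 2) = F
  have hr0 := hr.ne'
  push_cast
  field_simp
  linear_combination 4 * r ^ 3 * r ^ m * F * v r ^ 2 * hq

lemma two_lt_of_morawetz_exponent {m : ℕ} {q : ℝ} (hq : (q - 2) * (m + 3) = 4) : 2 < q := by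
  have hm : (0 : ℝ) < m + 3 := by positivity
  by_contra! h
  nlinarith [mul_nonneg (sub_nonneg.2 h) hm.le]

lemma continuous_morawetzBulk {m : ℕ} {q : ℝ} (hq : 0 ≤ q) {v : ℝ → ℝ} (hv : Continuous v) :
    Continuous (morawetzBulk m q v) := by
  unfold morawetzBulk
  have := hv.abs.rpow_const (p := q) (fun _ => Or.inr hq)
  fun_prop

lemma continuous_morawetzFlux {m : ℕ} {q : ℝ} (hq : 0 ≤ q) {v w z : ℝ → ℝ} (hv : Continuous v)
    (hw : Continuous w) (hz : Continuous z) : Continuous (morawetzFlux m q v w z) := by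
  unfold morawetzFlux
  have := hv.abs.rpow_const (p := q) (fun _ => Or.inr hq)
  fun_prop

/-- The truncated Morawetz identity on a time slice. -/
lemma integral_morawetzBulk {m : ℕ} {q b : ℝ} (hq : (q - 2) * (m + 3) = 4) (hb : 0 < b)
    {v w z y x w' : ℝ → ℝ} (hyc : Continuous y) (hxc : Continuous x)
    (hv : ∀ r, HasDerivAt v (w r) r) (hw : ∀ r, HasDerivAt w (w' r) r)
    (hz : ∀ r, HasDerivAt z (x r) r)
    (heq : ∀ r, 0 < r → y r - (w' r + ((m : ℝ) + 3) / r * w r) + |v r| ^ (q - 2) * v r = 0) :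
    ∫ r in (0 : ℝ)..b, (1 - r / b) * morawetzBulk m q v r =
      (∫ r in (0 : ℝ)..b, morawetzFlux m q v w z r) / b
        - ∫ r in (0 : ℝ)..b, (1 - r / b) * morawetzActionDeriv m v w z y x r := by
  have hq2 := two_lt_of_morawetz_exponent hq
  have hvc : Continuous v := continuous_iff_continuousAt.2 fun r => (hv r).continuousAt
  have hwc : Continuous w := continuous_iff_continuousAt.2 fun r => (hw r).continuousAt
  have hzc : Continuous z := continuous_iff_continuousAt.2 fun r => (hz r).continuousAt
  have hB := continuous_morawetzBulk (m := m) (q := q) (by linarith) hvc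
  have hF := continuous_morawetzFlux (m := m) (q := q) (by linarith) hvc hwc hzc
  have hA : Continuous (morawetzActionDeriv m v w z y x) := by
    unfold morawetzActionDeriv; fun_prop
  have hψB : Continuous fun r => (1 - r / b) * morawetzBulk m q v r := by fun_prop
  have hψA : Continuous fun r => (1 - r / b) * morawetzActionDeriv m v w z y x r := by fun_prop
  have hFb : Continuous fun r => morawetzFlux m q v w z r / b := by fun_prop
  have key := intervalIntegral.integral_eq_sub_of_hasDerivAt_of_le hb.le
    (f := fun r => (1 - r / b) * morawetzFlux m q v w z r)
    (f' := fun r => (1 - r / b) * morawetzBulk m q v r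
      + (1 - r / b) * morawetzActionDeriv m v w z y x r - morawetzFlux m q v w z r / b)
    (Continuous.continuousOn (by fun_prop))
    (fun r hr => by
      have h1 : HasDerivAt (fun r : ℝ => 1 - r / b) (-(1 / b)) r :=
        ((hasDerivAt_id r).div_const b).const_sub 1
      refine (h1.mul (hasDerivAt_morawetzFlux hq hr.1 (hv r) (hw r) (hz r)
        (heq r hr.1))).congr_deriv ?_
      ring)
    (Continuous.intervalIntegrable (by fun_prop) _ _)
  rw [intervalIntegral.integral_sub (Continuous.intervalIntegrable (by fun_prop) _ _)
      (hFb.intervalIntegrable _ _),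
    intervalIntegral.integral_add (hψB.intervalIntegrable _ _)
      (hψA.intervalIntegrable _ _), intervalIntegral.integral_div] at key
  have h0 : morawetzFlux m q v w z 0 = 0 := by simp [morawetzFlux]
  rw [h0, div_self hb.ne'] at key
  linarith

/-- A Hardy inequality on an interval, without boundary conditions. -/
lemma integral_hardy_le (m : ℕ) {b : ℝ} (hb : 0 < b) {v w : ℝ → ℝ} (hwc : Continuous w)
    (hv : ∀ r, HasDerivAt v (w r) r) :
    ∫ r in (0 : ℝ)..b, r ^ (m + 1) * v r ^ 2 ≤
      5 * ((∫ r in (0 : ℝ)..b, r ^ (m + 3) * w r ^ 2)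
        + (b ^ 2)⁻¹ * ∫ r in (0 : ℝ)..b, r ^ (m + 3) * v r ^ 2) := by
  have hvc : Continuous v := continuous_iff_continuousAt.2 fun r => (hv r).continuousAt
  set D : ℝ → ℝ := fun r => ((m : ℝ) + 2) * b * (r ^ (m + 1) * v r ^ 2)
    - ((m : ℝ) + 3) * (r ^ (m + 2) * v r ^ 2) + 2 * (b - r) * (r ^ (m + 2) * (v r * w r)) with hD
  have hDc : Continuous D := by fun_prop
  have key : ∫ r in (0 : ℝ)..b, D r = 0 := by
    rw [intervalIntegral.integral_eq_sub_of_hasDerivAt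
      (f := fun r => (b - r) * (r ^ (m + 2) * v r ^ 2)) _ (hDc.intervalIntegrable _ _)]
    · simp
    · intro r _
      refine (((hasDerivAt_id r).const_sub b).mul
        ((hasDerivAt_pow (m + 2) r).mul ((hv r).pow 2))).congr_deriv ?_
      simp only [hD, Pi.pow_apply, Pi.mul_apply, id]
      push_cast
      ring
  have hpt : ∀ r ∈ Icc (0 : ℝ) b, ((m : ℝ) + 2) * b / 2 * (r ^ (m + 1) * v r ^ 2) ≤
      D r + ((m : ℝ) + 2) * b * (r ^ (m + 3) * w r ^ 2 + 9 / 4 * (b ^ 2)⁻¹ *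
        (r ^ (m + 3) * v r ^ 2)) := by
    rintro r ⟨hr0, hrb⟩
    have hm : (0 : ℝ) ≤ m := by positivity
    obtain ⟨s, rfl⟩ : ∃ s, r = s * b := ⟨r / b, by field_simp⟩
    have hs0 : 0 ≤ s := nonneg_of_mul_nonneg_left hr0 hb
    have hs1 : s ≤ 1 := by nlinarith
    have h1 : (m + 3) * s * v (s * b) ^ 2 ≤
        (m + 2) * (1 / 4 * v (s * b) ^ 2 + 9 / 4 * s ^ 2 * v (s * b) ^ 2) := by
      have : (m + 3) * s ≤ (m + 2) * (1 / 4 + 9 / 4 * s ^ 2) := by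
        nlinarith [mul_nonneg hm (sq_nonneg (3 * s - 1)), sq_nonneg (3 * s - 1)]
      nlinarith [mul_le_mul_of_nonneg_right this (sq_nonneg (v (s * b)))]
    have h2 : -(2 * (1 - s) * (v (s * b) * (s * b * w (s * b)))) ≤
        (m + 2) * (1 / 4 * v (s * b) ^ 2 + (s * b * w (s * b)) ^ 2) := by
      generalize s * b * w (s * b) = Y
      generalize v (s * b) = X
      nlinarith [sq_nonneg (X + 2 * (1 - s) * Y), mul_nonneg hm (sq_nonneg X),
        mul_nonneg hm (sq_nonneg Y), sq_nonneg Y, mul_nonneg (sq_nonneg Y) hs0,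
        mul_nonneg (mul_nonneg (sq_nonneg Y) hs0) (sub_nonneg.2 hs1)]
    have h3 : 0 ≤ (s * b) ^ (m + 1) * b := by positivity
    have h4 := mul_le_mul_of_nonneg_left (add_le_add h1 h2) h3
    have hb0 := hb.ne'
    have e : 9 / 4 * (b ^ 2)⁻¹ * ((s * b) ^ (m + 3) * v (s * b) ^ 2)
        = (s * b) ^ (m + 1) * (9 / 4 * s ^ 2 * v (s * b) ^ 2) := by
      field_simp
      ring
    simp only [hD]
    rw [e]
    ring_nf at h4 ⊢
    linarith
  have hint : ((m : ℝ) + 2) * b / 2 * ∫ r in (0 : ℝ)..b, r ^ (m + 1) * v r ^ 2 ≤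
      ((m : ℝ) + 2) * b * ((∫ r in (0 : ℝ)..b, r ^ (m + 3) * w r ^ 2)
        + 9 / 4 * (b ^ 2)⁻¹ * ∫ r in (0 : ℝ)..b, r ^ (m + 3) * v r ^ 2) := by
    have hW : Continuous fun r : ℝ => r ^ (m + 3) * w r ^ 2 := by fun_prop
    have hV : Continuous fun r : ℝ => r ^ (m + 3) * v r ^ 2 := by fun_prop
    have hVk : Continuous fun r : ℝ => 9 / 4 * (b ^ 2)⁻¹ * (r ^ (m + 3) * v r ^ 2) := by fun_prop
    have := intervalIntegral.integral_mono_on (μ := volume) hb.le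
      (Continuous.intervalIntegrable (by fun_prop) _ _)
      (Continuous.intervalIntegrable (by fun_prop) _ _) hpt
    rw [intervalIntegral.integral_const_mul, intervalIntegral.integral_add
      (hDc.intervalIntegrable _ _) (Continuous.intervalIntegrable (by fun_prop) _ _), key,
      intervalIntegral.integral_const_mul, intervalIntegral.integral_add
      (hW.intervalIntegrable _ _) (hVk.intervalIntegrable _ _),
      intervalIntegral.integral_const_mul] at this
    linarith
  have hN : 0 ≤ (b ^ 2)⁻¹ * ∫ r in (0 : ℝ)..b, r ^ (m + 3) * v r ^ 2 := by
    refine mul_nonneg (by positivity) (intervalIntegral.integral_nonneg hb.le fun r hr => ?_)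
    have := hr.1
    positivity
  have hW : 0 ≤ ∫ r in (0 : ℝ)..b, r ^ (m + 3) * w r ^ 2 := by
    refine intervalIntegral.integral_nonneg hb.le fun r hr => ?_
    have := hr.1
    positivity
  have hmb : 0 < ((m : ℝ) + 2) * b := by positivity
  have : (1 / 2 : ℝ) * ∫ r in (0 : ℝ)..b, r ^ (m + 1) * v r ^ 2 ≤
      (∫ r in (0 : ℝ)..b, r ^ (m + 3) * w r ^ 2)
        + 9 / 4 * (b ^ 2)⁻¹ * ∫ r in (0 : ℝ)..b, r ^ (m + 3) * v r ^ 2 := by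
    refine le_of_mul_le_mul_left ?_ hmb
    linarith
  linarith

lemma integral_hardy_le_of_energy_le {m : ℕ} {b S : ℝ} (hb : 0 < b) {v w z : ℝ → ℝ}
    (hwc : Continuous w) (hzc : Continuous z) (hv : ∀ r, HasDerivAt v (w r) r)
    (hS : (∫ r in (0 : ℝ)..b, r ^ (m + 3) * (w r ^ 2 + z r ^ 2))
      + (b ^ 2)⁻¹ * (∫ r in (0 : ℝ)..b, r ^ (m + 3) * v r ^ 2) ≤ S) :
    (∫ r in (0 : ℝ)..b, r ^ (m + 1) * v r ^ 2) ≤ 5 * S ∧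
      (∫ r in (0 : ℝ)..b, r ^ (m + 3) * (w r ^ 2 + z r ^ 2)) ≤ S ∧ 0 ≤ S := by
  have hN : 0 ≤ (b ^ 2)⁻¹ * ∫ r in (0 : ℝ)..b, r ^ (m + 3) * v r ^ 2 := by
    refine mul_nonneg (by positivity) (intervalIntegral.integral_nonneg hb.le fun r hr => ?_)
    have := hr.1
    positivity
  have hE : 0 ≤ ∫ r in (0 : ℝ)..b, r ^ (m + 3) * (w r ^ 2 + z r ^ 2) := by
    refine intervalIntegral.integral_nonneg hb.le fun r hr => ?_
    have := hr.1
    positivity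
  have hW : ∫ r in (0 : ℝ)..b, r ^ (m + 3) * w r ^ 2 ≤
      ∫ r in (0 : ℝ)..b, r ^ (m + 3) * (w r ^ 2 + z r ^ 2) := by
    refine intervalIntegral.integral_mono_on (μ := volume) hb.le
      (Continuous.intervalIntegrable (by fun_prop) _ _)
      (Continuous.intervalIntegrable (by fun_prop) _ _) fun r hr => ?_
    have := pow_nonneg hr.1 (m + 3)
    gcongr
    nlinarith [sq_nonneg (z r)]
  have := integral_hardy_le m hb hwc hv
  exact ⟨by linarith, by linarith, by linarith⟩

lemma integral_morawetzFlux_le {m : ℕ} {q b S : ℝ} (hq : 0 < q) (hb : 0 < b) {v w z : ℝ → ℝ}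
    (hwc : Continuous w) (hzc : Continuous z) (hv : ∀ r, HasDerivAt v (w r) r)
    (hS : (∫ r in (0 : ℝ)..b, r ^ (m + 3) * (w r ^ 2 + z r ^ 2))
      + (b ^ 2)⁻¹ * (∫ r in (0 : ℝ)..b, r ^ (m + 3) * v r ^ 2) ≤ S) :
    ∫ r in (0 : ℝ)..b, morawetzFlux m q v w z r ≤ ((m : ℝ) + 3) * 3 * S := by
  obtain ⟨h1, h2, h3⟩ := integral_hardy_le_of_energy_le hb hwc hzc hv hS
  have hvc : Continuous v := continuous_iff_continuousAt.2 fun r => (hv r).continuousAt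
  have hEc : Continuous fun r => (1 / 2 + ((m : ℝ) + 3) / 4) *
    (r ^ (m + 3) * (w r ^ 2 + z r ^ 2)) := by fun_prop
  have hHc : Continuous fun r => ((m : ℝ) + 3) / 2 * (r ^ (m + 1) * v r ^ 2) := by fun_prop
  have key := intervalIntegral.integral_mono_on (μ := volume) hb.le
    ((continuous_morawetzFlux (m := m) hq.le hvc hwc hzc).intervalIntegrable 0 b)
    ((hEc.intervalIntegrable 0 b).add (hHc.intervalIntegrable 0 b)) (fun r hr => by
      have hr0 := hr.1
      have hm : (0 : ℝ) < m + 3 := by positivity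
      have hV : 0 ≤ r ^ (m + 3) * (|v r| ^ q / q) := by positivity
      have hY : 0 ≤ ((m : ℝ) + 3) / 4 * (r ^ (m + 1) * ((v r - r * w r) ^ 2 + (r * z r) ^ 2)) := by
        positivity
      simp only [morawetzFlux]
      ring_nf at hV hY ⊢
      linarith)
  rw [intervalIntegral.integral_add (hEc.intervalIntegrable 0 b) (hHc.intervalIntegrable 0 b),
    intervalIntegral.integral_const_mul, intervalIntegral.integral_const_mul] at key
  have hm : (0 : ℝ) ≤ m := by positivity
  nlinarith [mul_nonneg hm h3, mul_le_mul_of_nonneg_left h1 hm, mul_le_mul_of_nonneg_left h2 hm]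

/-- The radial Morawetz action density. -/
def morawetzAction (m : ℕ) (v w z : ℝ → ℝ) (r : ℝ) : ℝ :=
  r ^ (m + 3) * (z r * w r) + ((m : ℝ) + 3) / 2 * (r ^ (m + 2) * (z r * v r))

lemma abs_integral_morawetzAction_le {m : ℕ} {b S : ℝ} (hb : 0 < b) {v w z : ℝ → ℝ}
    (hwc : Continuous w) (hzc : Continuous z) (hv : ∀ r, HasDerivAt v (w r) r)
    (hS : (∫ r in (0 : ℝ)..b, r ^ (m + 3) * (w r ^ 2 + z r ^ 2))
      + (b ^ 2)⁻¹ * (∫ r in (0 : ℝ)..b, r ^ (m + 3) * v r ^ 2) ≤ S) :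
    |∫ r in (0 : ℝ)..b, (1 - r / b) * morawetzAction m v w z r| ≤ ((m : ℝ) + 3) * 2 * S := by
  obtain ⟨h1, h2, h3⟩ := integral_hardy_le_of_energy_le hb hwc hzc hv hS
  have hvc : Continuous v := continuous_iff_continuousAt.2 fun r => (hv r).continuousAt
  have hEc : Continuous fun r => (1 / 2 + ((m : ℝ) + 3) / 4) *
    (r ^ (m + 3) * (w r ^ 2 + z r ^ 2)) := by fun_prop
  have hHc : Continuous fun r => ((m : ℝ) + 3) / 4 * (r ^ (m + 1) * v r ^ 2) := by fun_prop
  have hAc : Continuous fun r => (1 - r / b) * morawetzAction m v w z r := by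
    unfold morawetzAction
    fun_prop
  refine (intervalIntegral.abs_integral_le_integral_abs hb.le).trans ?_
  have key := intervalIntegral.integral_mono_on (μ := volume) hb.le
    (hAc.abs.intervalIntegrable 0 b)
    ((hEc.intervalIntegrable 0 b).add (hHc.intervalIntegrable 0 b)) (fun r hr => by
      have hr0 := hr.1
      have hψ0 : 0 ≤ 1 - r / b := sub_nonneg.2 ((div_le_one hb).2 hr.2)
      have hψ1 : 1 - r / b ≤ 1 := by
        have := div_nonneg hr0 hb.le
        linarith
      rw [abs_mul, abs_of_nonneg hψ0]
      refine (mul_le_of_le_one_left (abs_nonneg _) hψ1).trans (abs_le.2 ?_)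
      have hY : 0 ≤ ((m : ℝ) + 3) / 4 * (r ^ (m + 1) * ((v r - r * z r) ^ 2 + (r * w r) ^ 2)) := by
        positivity
      have hY' : 0 ≤ ((m : ℝ) + 3) / 4 * (r ^ (m + 1) * ((v r + r * z r) ^ 2 + (r * w r) ^ 2)) := by
        positivity
      have hZ : 0 ≤ r ^ (m + 3) * (w r - z r) ^ 2 / 2 := by positivity
      have hZ' : 0 ≤ r ^ (m + 3) * (w r + z r) ^ 2 / 2 := by positivity
      simp only [morawetzAction]
      ring_nf at hY hY' hZ hZ' ⊢
      constructor <;> linarith)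
  rw [intervalIntegral.integral_add (hEc.intervalIntegrable 0 b) (hHc.intervalIntegrable 0 b),
    intervalIntegral.integral_const_mul, intervalIntegral.integral_const_mul] at key
  have hm : (0 : ℝ) ≤ m := by positivity
  nlinarith [mul_nonneg hm h3, mul_le_mul_of_nonneg_left h1 hm, mul_le_mul_of_nonneg_left h2 hm]

/-- The truncated Morawetz estimate in radial coordinates. -/
lemma radial_truncated_morawetz {m : ℕ} {q b T S : ℝ} (hq : (q - 2) * (m + 3) = 4) (hb : 0 < b)
    (hT : 0 ≤ T) {v w z y x k : ℝ → ℝ → ℝ}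
    (hvc : Continuous (Function.uncurry v)) (hwc : Continuous (Function.uncurry w))
    (hzc : Continuous (Function.uncurry z)) (hyc : Continuous (Function.uncurry y))
    (hxc : Continuous (Function.uncurry x))
    (hv : ∀ t r, HasDerivAt (v t) (w t r) r) (hw : ∀ t r, HasDerivAt (w t) (k t r) r)
    (hz : ∀ t r, HasDerivAt (z t) (x t r) r)
    (hvt : ∀ t r, HasDerivAt (fun s => v s r) (z t r) t)
    (hwt : ∀ t r, HasDerivAt (fun s => w s r) (x t r) t)
    (hzt : ∀ t r, HasDerivAt (fun s => z s r) (y t r) t)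
    (heq : ∀ t ∈ Icc 0 T, ∀ r, 0 < r →
      y t r - (k t r + ((m : ℝ) + 3) / r * w t r) + |v t r| ^ (q - 2) * v t r = 0)
    (hS : ∀ t ∈ Icc 0 T, (∫ r in (0 : ℝ)..b, r ^ (m + 3) * (w t r ^ 2 + z t r ^ 2))
      + (b ^ 2)⁻¹ * (∫ r in (0 : ℝ)..b, r ^ (m + 3) * v t r ^ 2) ≤ S) :
    ∫ t in (0 : ℝ)..T, ∫ r in (0 : ℝ)..b,
        (1 - r / b) * (r ^ (m + 2) * |v t r| ^ q + r ^ m * v t r ^ 2) ≤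
      ((m : ℝ) + 3) * (6 * T / b + 8) * S := by
  have hq2 := two_lt_of_morawetz_exponent hq
  have hm : (0 : ℝ) ≤ m := by positivity
  have hr2 : Continuous fun p : ℝ × ℝ => |Function.uncurry v p| ^ q :=
    hvc.abs.rpow_const (fun _ => Or.inr (by linarith))
  have slice : ∀ {f : ℝ → ℝ → ℝ}, Continuous (Function.uncurry f) → ∀ t, Continuous (f t) :=
    fun hf t => hf.comp (Continuous.prodMk_right t)
  have slice' : ∀ {f : ℝ → ℝ → ℝ}, Continuous (Function.uncurry f) → ∀ r,
    Continuous (fun t => f t r) := fun hf r => hf.comp (Continuous.prodMk_left r)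
  have hDc : Continuous (Function.uncurry fun t r => (1 - r / b) *
      (r ^ (m + 2) * |v t r| ^ q + r ^ m * v t r ^ 2)) := by
    simp only [Function.uncurry_def] at *
    fun_prop
  have hBc : Continuous (Function.uncurry fun t r => (1 - r / b) * morawetzBulk m q (v t) r) := by
    simp only [Function.uncurry_def, morawetzBulk] at *
    fun_prop
  have hFc : Continuous (Function.uncurry fun t r => morawetzFlux m q (v t) (w t) (z t) r) := by
    simp only [Function.uncurry_def, morawetzFlux] at *
    fun_prop
  have hAc : Continuous (Function.uncurry fun t r =>
      (1 - r / b) * morawetzActionDeriv m (v t) (w t) (z t) (y t) (x t) r) := by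
    simp only [Function.uncurry_def, morawetzActionDeriv] at *
    fun_prop
  have hMc : ∀ t, Continuous fun r => (1 - r / b) * morawetzAction m (v t) (w t) (z t) r := by
    intro t
    have h1 := slice hvc t
    have h2 := slice hwc t
    have h3 := slice hzc t
    unfold morawetzAction
    fun_prop
  have hFi := intervalIntegral.continuous_parametric_intervalIntegral_of_continuous' (μ := volume)
    hFc 0 b
  have hAi := intervalIntegral.continuous_parametric_intervalIntegral_of_continuous' (μ := volume)
    hAc 0 b
  have hDi := intervalIntegral.continuous_parametric_intervalIntegral_of_continuous' (μ := volume)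
    hDc 0 b
  have hBi := intervalIntegral.continuous_parametric_intervalIntegral_of_continuous' (μ := volume)
    hBc 0 b
  have hid : ∫ t in (0 : ℝ)..T, ∫ r in (0 : ℝ)..b, (1 - r / b) * morawetzBulk m q (v t) r =
      (∫ t in (0 : ℝ)..T, (∫ r in (0 : ℝ)..b, morawetzFlux m q (v t) (w t) (z t) r) / b)
      - ∫ t in (0 : ℝ)..T, ∫ r in (0 : ℝ)..b,
        (1 - r / b) * morawetzActionDeriv m (v t) (w t) (z t) (y t) (x t) r := by
    rw [← intervalIntegral.integral_sub ((hFi.div_const b).intervalIntegrable _ _)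
      (hAi.intervalIntegrable _ _)]
    refine intervalIntegral.integral_congr fun t ht => ?_
    rw [uIcc_of_le hT] at ht
    exact integral_morawetzBulk hq hb (slice hyc t) (slice hxc t) (hv t) (hw t) (hz t) (heq t ht)
  have hflux : ∫ t in (0 : ℝ)..T, (∫ r in (0 : ℝ)..b, morawetzFlux m q (v t) (w t) (z t) r) / b ≤
      T * (((m : ℝ) + 3) * 3 * S / b) := by
    have := intervalIntegral.integral_mono_on (μ := volume) hT
      ((hFi.div_const b).intervalIntegrable (μ := volume) _ _)
      (intervalIntegrable_const (c := ((m : ℝ) + 3) * 3 * S / b)) (fun t ht =>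
        div_le_div_of_nonneg_right (integral_morawetzFlux_le (by linarith : 0 < q) hb (slice hwc t)
          (slice hzc t) (hv t) (hS t ht)) hb.le)
    rwa [intervalIntegral.integral_const, sub_zero, smul_eq_mul] at this
  have hact : ∫ t in (0 : ℝ)..T, ∫ r in (0 : ℝ)..b,
        (1 - r / b) * morawetzActionDeriv m (v t) (w t) (z t) (y t) (x t) r =
      (∫ r in (0 : ℝ)..b, (1 - r / b) * morawetzAction m (v T) (w T) (z T) r)
        - ∫ r in (0 : ℝ)..b, (1 - r / b) * morawetzAction m (v 0) (w 0) (z 0) r := by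
    rw [intervalIntegral_intervalIntegral_swap, ← intervalIntegral.integral_sub
      ((hMc T).intervalIntegrable _ _) ((hMc 0).intervalIntegrable _ _)]
    · refine intervalIntegral.integral_congr fun r _ => ?_
      refine intervalIntegral.integral_eq_sub_of_hasDerivAt
        (f := fun t => (1 - r / b) * morawetzAction m (v t) (w t) (z t) r) (fun t _ => ?_)
        ((slice' hAc r).intervalIntegrable _ _)
      refine ((((hzt t r).mul (hwt t r)).const_mul (r ^ (m + 3))).add
        ((((hzt t r).mul (hvt t r)).const_mul (r ^ (m + 2))).const_mul
          (((m : ℝ) + 3) / 2))).const_mul (1 - r / b) |>.congr_deriv ?_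
      simp only [morawetzActionDeriv]
      ring
    · exact (hAc.continuousOn.integrableOn_compact
        (isCompact_uIcc.prod isCompact_uIcc)).mono_set
        (prod_mono uIoc_subset_uIcc uIoc_subset_uIcc)
  have hMT := abs_le.1 (abs_integral_morawetzAction_le hb (slice hwc T) (slice hzc T) (hv T)
    (hS T ⟨hT, le_rfl⟩))
  have hM0 := abs_le.1 (abs_integral_morawetzAction_le hb (slice hwc 0) (slice hzc 0) (hv 0)
    (hS 0 ⟨le_rfl, hT⟩))
  have hcmp : ∫ t in (0 : ℝ)..T, ∫ r in (0 : ℝ)..b,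
      (1 - r / b) * (r ^ (m + 2) * |v t r| ^ q + r ^ m * v t r ^ 2) ≤
      ∫ t in (0 : ℝ)..T, 2 * ∫ r in (0 : ℝ)..b, (1 - r / b) * morawetzBulk m q (v t) r := by
    refine intervalIntegral.integral_mono_on (μ := volume) hT (hDi.intervalIntegrable _ _)
      ((hBi.const_mul 2).intervalIntegrable _ _) fun t _ => ?_
    rw [← intervalIntegral.integral_const_mul]
    refine intervalIntegral.integral_mono_on (μ := volume) hb.le ((slice hDc t).intervalIntegrable _ _)
      (((slice hBc t).const_mul 2).intervalIntegrable _ _) fun r hr => ?_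
    have hψ : 0 ≤ 1 - r / b := sub_nonneg.2 ((div_le_one hb).2 hr.2)
    have hr0 := hr.1
    have h1 : 1 / 2 ≤ 2 / q := by
      rw [div_le_div_iff₀ (by norm_num) (by linarith)]
      nlinarith
    have h2 : 1 / 2 ≤ ((m : ℝ) + 3) * (m + 1) / 4 := by nlinarith
    have h3 : 0 ≤ r ^ (m + 2) * |v t r| ^ q := by positivity
    have h4 : 0 ≤ r ^ m * v t r ^ 2 := by positivity
    simp only [morawetzBulk]
    rw [mul_left_comm 2]
    refine mul_le_mul_of_nonneg_left ?_ hψ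
    nlinarith
  rw [intervalIntegral.integral_const_mul, hid, hact] at hcmp
  have e : ((m : ℝ) + 3) * (6 * T / b + 8) * S =
    2 * (T * (((m : ℝ) + 3) * 3 * S / b) + 2 * (((m : ℝ) + 3) * 2 * S)) := by field_simp; ring
  linarith

lemma le_mul_two_sub_norm {d : ℕ} (hd : 0 < d) {χ : Euc d → ℝ} {K : NNReal}
    (hK : LipschitzWith K χ) (hχout : ∀ x : Euc d, 2 ≤ ‖x‖ → χ x = 0) {x : Euc d} (hx : ‖x‖ ≤ 2) :
    χ x ≤ K * (2 - ‖x‖) := by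
  obtain ⟨y, hy, hxy⟩ : ∃ y : Euc d, ‖y‖ = 2 ∧ ‖x - y‖ = 2 - ‖x‖ := by
    by_cases h0 : x = 0
    · refine ⟨(2 : ℝ) • EuclideanSpace.single ⟨0, hd⟩ (1 : ℝ), ?_, ?_⟩ <;>
        simp [h0, norm_smul]
    · have hp : 0 < ‖x‖ := norm_pos_iff.2 h0
      refine ⟨(2 / ‖x‖) • x, ?_, ?_⟩
      · rw [norm_smul, Real.norm_of_nonneg (by positivity)]
        field_simp
      · rw [show x - (2 / ‖x‖) • x = (-(2 / ‖x‖ - 1)) • x by module, norm_smul, norm_neg,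
          Real.norm_of_nonneg (sub_nonneg.2 ((one_le_div hp).2 hx))]
        field_simp
  have := hK.dist_le_mul x y
  rw [hχout y hy.ge, Real.dist_eq, sub_zero, dist_eq_norm, hxy] at this
  exact (le_abs_self _).trans this

lemma hasDerivAt_fst_slice {F : ℝ × ℝ → ℝ} (hF : Differentiable ℝ F) (t r : ℝ) :
    HasDerivAt (fun s => F (s, r)) (fderiv ℝ F (t, r) (1, 0)) t :=
  (hF (t, r)).hasFDerivAt.comp_hasDerivAt t ((hasDerivAt_id t).prodMk (hasDerivAt_const t r))

lemma hasDerivAt_snd_slice {F : ℝ × ℝ → ℝ} (hF : Differentiable ℝ F) (t r : ℝ) :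
    HasDerivAt (fun s => F (t, s)) (fderiv ℝ F (t, r) (0, 1)) r :=
  (hF (t, r)).hasFDerivAt.comp_hasDerivAt r ((hasDerivAt_const r t).prodMk (hasDerivAt_id r))

lemma contDiff_fderiv_apply_const {E : Type*} [NormedAddCommGroup E] [NormedSpace ℝ E]
    {F : E → ℝ} (hF : ContDiff ℝ (⊤ : ℕ∞) F) (a : E) :
    ContDiff ℝ (⊤ : ℕ∞) fun p => fderiv ℝ F p a :=
  (hF.fderiv_right (m := (⊤ : ℕ∞)) (by simp)).clm_apply contDiff_const

lemma fderiv_fderiv_apply_comm {E : Type*} [NormedAddCommGroup E] [NormedSpace ℝ E]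
    {F : E → ℝ} (hF : ContDiff ℝ (⊤ : ℕ∞) F) (p a c : E) :
    fderiv ℝ (fun y => fderiv ℝ F y a) p c = fderiv ℝ (fun y => fderiv ℝ F y c) p a := by
  have hd : DifferentiableAt ℝ (fderiv ℝ F) p :=
    (hF.fderiv_right (m := (⊤ : ℕ∞)) (by simp)).differentiable (by simp) p
  have h := hF.contDiffAt.isSymmSndFDerivAt (x := p) (by
    simpa using (WithTop.coe_le_coe.2 le_top : ((2 : ℕ∞) : WithTop ℕ∞) ≤ (⊤ : ℕ∞))) c a
  rw [fderiv_clm_apply hd (by simp), fderiv_clm_apply hd (by simp)]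
  simpa using h

lemma fderiv_fderiv_apply_eq {E : Type*} [NormedAddCommGroup E] [NormedSpace ℝ E]
    {F : E → ℝ} (hF : ContDiff ℝ (⊤ : ℕ∞) F) (p a : E) {g' : ℝ → ℝ} {c : ℝ}
    (h1 : ∀ s, HasDerivAt (fun s : ℝ => F (p + s • a)) (g' s) s) (h2 : HasDerivAt g' c 0) :
    fderiv ℝ (fun y => fderiv ℝ F y a) p a = c := by
  have hline : ∀ s : ℝ, HasDerivAt (fun s : ℝ => p + s • a) a s := fun s => by
    simpa using ((hasDerivAt_id s).smul_const a).const_add p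
  have hg : g' = fun s => fderiv ℝ F (p + s • a) a := by
    funext s
    exact (h1 s).unique
      (((hF.differentiable (by simp)) (p + s • a)).hasFDerivAt.comp_hasDerivAt s (hline s))
  have h3 := ((contDiff_fderiv_apply_const hF a).differentiable (by simp)
    (p + (0 : ℝ) • a)).hasFDerivAt.comp_hasDerivAt (0 : ℝ) (hline 0)
  rw [hg] at h2
  simpa using h3.unique h2

/-- The Laplacian of a radial function in polar coordinates. -/
lemma spatialLap_radial {d : ℕ} {f : Euc d → ℝ} (hf : ContDiff ℝ (⊤ : ℕ∞) f) (i₀ : Fin d)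
    {φ φ' φ'' : ℝ → ℝ} (hφ : ∀ r, HasDerivAt φ (φ' r) r) (hφ' : ∀ r, HasDerivAt φ' (φ'' r) r)
    (hline : ∀ s : ℝ, f (s • EuclideanSpace.single i₀ 1) = φ s) (hrad : ∀ x, f x = φ ‖x‖)
    {r : ℝ} (hr : 0 < r) :
    spatialLap d f (r • EuclideanSpace.single i₀ 1) = φ'' r + ((d : ℝ) - 1) / r * φ' r := by
  have hi₀ : fderiv ℝ (fun y => fderiv ℝ f y (EuclideanSpace.single i₀ 1))
      (r • EuclideanSpace.single i₀ 1) (EuclideanSpace.single i₀ 1) = φ'' r := by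
    refine fderiv_fderiv_apply_eq hf _ _ (g' := fun s => φ' (r + s)) (fun s => ?_) ?_
    · simp only [← add_smul, hline]
      exact (hφ (r + s)).comp_const_add r s
    · exact HasDerivAt.comp_const_add r 0 (by simpa using hφ' r)
  have hi : ∀ i ∈ Finset.univ.erase i₀, fderiv ℝ (fun y => fderiv ℝ f y (EuclideanSpace.single i 1))
      (r • EuclideanSpace.single i₀ 1) (EuclideanSpace.single i 1) = φ' r / r := by
    intro i hi
    have hne : i ≠ i₀ := (Finset.mem_erase.1 hi).1
    have hnorm : ∀ s : ℝ, ‖r • EuclideanSpace.single i₀ (1 : ℝ) + s • EuclideanSpace.single i 1‖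
        = √(r ^ 2 + s ^ 2) := by
      intro s
      have hin : ⟪r • EuclideanSpace.single i₀ (1 : ℝ), s • EuclideanSpace.single i (1 : ℝ)⟫ = 0 := by
        simp [inner_smul_left, inner_smul_right, EuclideanSpace.inner_single_left,
          hne.symm]
      rw [← Real.sqrt_sq (norm_nonneg _), pow_two,
        norm_add_sq_eq_norm_sq_add_norm_sq_real hin]
      simp [norm_smul, pow_two]
    have hsq : ∀ s : ℝ, HasDerivAt (fun s => √(r ^ 2 + s ^ 2)) (s / √(r ^ 2 + s ^ 2)) s := by
      intro s
      refine (((hasDerivAt_pow 2 s).const_add (r ^ 2)).sqrt (by positivity)).congr_deriv ?_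
      field_simp
      simp
    refine fderiv_fderiv_apply_eq hf _ _
      (g' := fun s => φ' √(r ^ 2 + s ^ 2) * (s / √(r ^ 2 + s ^ 2))) (fun s => ?_) ?_
    · simp only [hrad, hnorm]
      exact (hφ _).comp s (hsq s)
    · have h0 : √(r ^ 2 + 0 ^ 2) = r := by simp [Real.sqrt_sq hr.le]
      have h1 := ((hφ' √(r ^ 2 + 0 ^ 2)).comp (0 : ℝ) (hsq 0)).mul
        ((hasDerivAt_id (0 : ℝ)).div (hsq 0) (by rw [h0]; exact hr.ne'))
      refine h1.congr_deriv ?_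
      simp only [h0, Function.comp_apply, id]
      field_simp
      simp only [mul_zero, zero_mul, zero_add]
      ring
  unfold spatialLap
  rw [← Finset.add_sum_erase _ _ (Finset.mem_univ i₀), hi₀, Finset.sum_congr rfl hi,
    Finset.sum_const, Finset.card_erase_of_mem (Finset.mem_univ _), nsmul_eq_mul]
  have : 1 ≤ d := Fin.pos i₀
  simp [Nat.cast_sub this]
  ring

/-- Integration in polar coordinates of a radial function over a ball. -/
lemma integral_closedBall_norm {m : ℕ} {b : ℝ} (hb : 0 < b) {g h : ℝ → ℝ} (hh : Continuous h)
    (hgh : ∀ r, 0 < r → r ^ (m + 3) * g r = h r) :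
    IntegrableOn (fun x : Euc (m + 4) => g ‖x‖) (Metric.closedBall 0 b) ∧
      ∫ x in Metric.closedBall (0 : Euc (m + 4)) b, g ‖x‖ =
        (((m + 4 : ℕ) : ℝ) * volume.real (Metric.ball (0 : Euc (m + 4)) 1)) *
          ∫ r in (0 : ℝ)..b, h r := by
  have hind : (Metric.closedBall (0 : Euc (m + 4)) b).indicator (fun x => g ‖x‖) =
      fun x => (Iic b).indicator g ‖x‖ := by
    funext x
    simp [indicator]
  have hcongr : ∀ r ∈ Ioi (0 : ℝ), r ^ (m + 3) • (Iic b).indicator g r = (Iic b).indicator h r := by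
    intro r hr
    by_cases hrb : r ≤ b
    · simp [hrb, hgh r hr]
    · simp [hrb]
  have hfin : Module.finrank ℝ (Euc (m + 4)) = m + 4 := by simp
  constructor
  · rw [← integrable_indicator_iff measurableSet_closedBall, hind, integrable_fun_norm_addHaar,
      hfin]
    refine (integrableOn_congr_fun hcongr measurableSet_Ioi).2 ?_
    rw [IntegrableOn, integrable_indicator_iff measurableSet_Iic, IntegrableOn,
      Measure.restrict_restrict measurableSet_Iic, Iic_inter_Ioi]
    exact (hh.integrableOn_Icc).mono_set Ioc_subset_Icc_self
  · rw [← integral_indicator measurableSet_closedBall, hind, integral_fun_norm_addHaar, hfin,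
      show m + 4 - 1 = m + 3 from rfl, setIntegral_congr_fun measurableSet_Ioi hcongr,
      setIntegral_indicator measurableSet_Iic, Ioi_inter_Iic,
      ← intervalIntegral.integral_of_le hb.le, nsmul_eq_mul, smul_eq_mul, mul_assoc]

/-- The slice `(t, r) ↦ u(t, r e)` along the first coordinate axis. -/
def axisSlice {d : ℕ} (i₀ : Fin d) (u : ℝ → Euc d → ℝ) (p : ℝ × ℝ) : ℝ :=
  u p.1 (p.2 • EuclideanSpace.single i₀ 1)

lemma contDiff_axisSlice {d : ℕ} (i₀ : Fin d) {u : ℝ → Euc d → ℝ}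
    (hu : ContDiff ℝ (⊤ : ℕ∞) (Function.uncurry u)) :
    ContDiff ℝ (⊤ : ℕ∞) (axisSlice i₀ u) :=
  hu.comp (contDiff_fst.prodMk (contDiff_snd.smul contDiff_const))

lemma IsRadial.eq_axisSlice {d : ℕ} (i₀ : Fin d) {u : ℝ → Euc d → ℝ} {t : ℝ}
    (h : IsRadial d (u t)) (x : Euc d) : u t x = axisSlice i₀ u (t, ‖x‖) := by
  obtain ⟨g, hg⟩ := h
  simp [axisSlice, hg, norm_smul]

lemma contDiff_time_slice {d : ℕ} {u : ℝ → Euc d → ℝ}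
    (hu : ContDiff ℝ (⊤ : ℕ∞) (Function.uncurry u)) (x : Euc d) :
    ContDiff ℝ (⊤ : ℕ∞) (fun s => u s x) :=
  hu.comp (contDiff_id.prodMk contDiff_const)

lemma contDiff_space_slice {d : ℕ} {u : ℝ → Euc d → ℝ}
    (hu : ContDiff ℝ (⊤ : ℕ∞) (Function.uncurry u)) (t : ℝ) :
    ContDiff ℝ (⊤ : ℕ∞) (u t) :=
  hu.comp (contDiff_const.prodMk contDiff_id)

/-- The time derivative of a function that is radial on a time interval is radial there. -/
lemma timeDeriv_eq_axisSlice {d : ℕ} (i₀ : Fin d) {u : ℝ → Euc d → ℝ} {T : ℝ} (hT : 0 < T)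
    (hu : ContDiff ℝ (⊤ : ℕ∞) (Function.uncurry u))
    (hrad : ∀ t ∈ Icc (0 : ℝ) T, IsRadial d (u t)) {t : ℝ} (ht : t ∈ Icc (0 : ℝ) T) (x : Euc d) :
    timeDeriv d u t x = fderiv ℝ (axisSlice i₀ u) (t, ‖x‖) (1, 0) := by
  have h1 : HasDerivAt (fun s => u s x) (timeDeriv d u t x) t :=
    ((contDiff_time_slice hu x).differentiable (by simp) t).hasDerivAt
  have h2 := hasDerivAt_fst_slice ((contDiff_axisSlice i₀ hu).differentiable (by simp)) t ‖x‖
  have h3 : HasDerivWithinAt (fun s => u s x)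
      (fderiv ℝ (axisSlice i₀ u) (t, ‖x‖) (1, 0)) (Icc 0 T) t :=
    h2.hasDerivWithinAt.congr (fun s hs => (hrad s hs).eq_axisSlice i₀ x)
      ((hrad t ht).eq_axisSlice i₀ x)
  exact (uniqueDiffOn_Icc hT t ht).eq_deriv _ h1.hasDerivWithinAt h3

lemma abs_fderiv_axisSlice_le_norm_gradient {d : ℕ} (i₀ : Fin d) {u : ℝ → Euc d → ℝ}
    (hu : ContDiff ℝ (⊤ : ℕ∞) (Function.uncurry u)) {t : ℝ} (hrad : IsRadial d (u t))
    {x : Euc d} (hx : x ≠ 0) :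
    |fderiv ℝ (axisSlice i₀ u) (t, ‖x‖) (0, 1)| ≤ ‖gradient (u t) x‖ := by
  have hp : 0 < ‖x‖ := norm_pos_iff.2 hx
  have h1 := hasDerivAt_snd_slice ((contDiff_axisSlice i₀ hu).differentiable (by simp)) t ‖x‖
  have h2 : HasDerivAt (fun s : ℝ => u t (s • (‖x‖⁻¹ • x)))
      (fderiv ℝ (u t) (‖x‖ • (‖x‖⁻¹ • x)) (‖x‖⁻¹ • x)) ‖x‖ := by
    refine ((contDiff_space_slice hu t).differentiable (by simp) _).hasFDerivAt.comp_hasDerivAt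
      _ ?_
    simpa using (hasDerivAt_id ‖x‖).smul_const (‖x‖⁻¹ • x)
  have h3 : (fun s => axisSlice i₀ u (t, s)) =ᶠ[nhds ‖x‖]
      fun s : ℝ => u t (s • (‖x‖⁻¹ • x)) := by
    filter_upwards [lt_mem_nhds hp] with s hs
    rw [hrad.eq_axisSlice i₀ (s • (‖x‖⁻¹ • x)), norm_smul, norm_smul, norm_inv, norm_norm,
      inv_mul_cancel₀ hp.ne', mul_one, Real.norm_of_nonneg hs.le]
  rw [h1.unique (h2.congr_of_eventuallyEq h3), smul_inv_smul₀ hp.ne', ← Real.norm_eq_abs,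
    gradient, LinearIsometryEquiv.norm_map]
  refine ((fderiv ℝ (u t) x).le_opNorm _).trans_eq ?_
  rw [norm_smul, norm_inv, norm_norm, inv_mul_cancel₀ hp.ne', mul_one]

lemma continuous_timeDeriv {d : ℕ} {u : ℝ → Euc d → ℝ}
    (hu : ContDiff ℝ (⊤ : ℕ∞) (Function.uncurry u)) (t : ℝ) :
    Continuous fun x => timeDeriv d u t x := by
  have h : (fun x => timeDeriv d u t x) = fun x => fderiv ℝ (Function.uncurry u) (t, x) (1, 0) := by
    funext x
    exact (((hu.differentiable (by simp)) (t, x)).hasFDerivAt.comp_hasDerivAt t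
      ((hasDerivAt_id t).prodMk (hasDerivAt_const t x))).deriv
  rw [h]
  exact (contDiff_fderiv_apply_const hu _).continuous.comp (Continuous.prodMk_right t)

lemma continuous_norm_gradient {d : ℕ} {f : Euc d → ℝ} (hf : ContDiff ℝ (⊤ : ℕ∞) f) :
    Continuous fun x => ‖gradient f x‖ := by
  simp only [gradient, LinearIsometryEquiv.norm_map]
  exact (hf.continuous_fderiv (by simp)).norm

/-- **Truncated Morawetz estimate** (Proposition 5.3). For `d ≥ 4`, a smooth cutoff `χ`
(equal to `1` on the unit ball and `0` outside the ball of radius `2`) and `δ > 0`,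
any radial classical solution `u` of the defocusing conformal NLW on `[0, T] × ℝ^d`
satisfies
`∫_0^T ∫ χ(x/(δT)) [u²/|x|³ + |u|^{2(d+1)/(d−1)}/|x|] dx dt
  ≤ C (sup_{t∈[0,T]} ‖∇_{t,x}u(t)‖²_{L²(|x|≤2δT)}
      + sup_{t∈[0,T]} (δT)⁻² ‖u(t)‖²_{L²(|x|≤2δT)})`,
with `C` depending only on `d`, `δ`, and `χ`. -/
theorem truncated_morawetz_estimate (d : ℕ) (hd : 4 ≤ d)
    (χ : Euc d → ℝ) (hχs : ContDiff ℝ (⊤ : ℕ∞) χ) (hχc : HasCompactSupport χ)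
    (hχ0 : ∀ x, 0 ≤ χ x) (hχ1 : ∀ x, χ x ≤ 1)
    (hχin : ∀ x : Euc d, ‖x‖ ≤ 1 → χ x = 1) (hχout : ∀ x : Euc d, 2 ≤ ‖x‖ → χ x = 0)
    (δ : ℝ) (hδ : 0 < δ) :
    ∃ C : ℝ, 0 < C ∧
      ∀ (T : ℝ), 0 < T → ∀ u : ℝ → Euc d → ℝ,
        ContDiff ℝ (⊤ : ℕ∞) (Function.uncurry u) →
        (∀ t, HasCompactSupport (u t)) →
        (∀ t, HasCompactSupport (fun x => timeDeriv d u t x)) →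
        (∀ t ∈ Icc (0 : ℝ) T, IsRadial d (u t)) →
        (∀ t ∈ Icc (0 : ℝ) T, ∀ x, timeDeriv2 d u t x - spatialLap d (u t) x
            + |u t x| ^ ((4 : ℝ) / ((d : ℝ) - 1)) * u t x = 0) →
        (∫⁻ t in Icc (0 : ℝ) T, ∫⁻ x : Euc d,
            ENNReal.ofReal (χ ((δ * T)⁻¹ • x) *
              ((u t x) ^ 2 / ‖x‖ ^ 3 +
                |u t x| ^ (2 * ((d : ℝ) + 1) / ((d : ℝ) - 1)) / ‖x‖))) ≤
          ENNReal.ofReal C *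
            ((⨆ t ∈ Icc (0 : ℝ) T, ENNReal.ofReal
                (∫ x in Metric.closedBall (0 : Euc d) (2 * δ * T),
                  (‖gradient (u t) x‖ ^ 2 + (timeDeriv d u t x) ^ 2))) +
              (⨆ t ∈ Icc (0 : ℝ) T, ENNReal.ofReal
                (((δ * T) ^ 2)⁻¹ *
                  ∫ x in Metric.closedBall (0 : Euc d) (2 * δ * T), (u t x) ^ 2))) := by
  obtain ⟨K, hK⟩ := (hχs.of_le (m := 1) (by simp)).lipschitzWith_of_hasCompactSupport hχc (by simp)
  obtain ⟨m, rfl⟩ : ∃ m, d = m + 4 := ⟨d - 4, by omega⟩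
  refine ⟨2 * (K + 1) * (((m : ℝ) + 3) * (3 / δ + 8)), by positivity, ?_⟩
  intro T hT u hu _ _ hrad heq
  set b : ℝ := 2 * δ * T with hb
  have hb0 : 0 < b := by positivity
  set q : ℝ := 2 * (((m + 4 : ℕ) : ℝ) + 1) / (((m + 4 : ℕ) : ℝ) - 1) with hq
  have hm3 : ((m + 4 : ℕ) : ℝ) - 1 = m + 3 := by push_cast; ring
  have hm3' : (0 : ℝ) < m + 3 := by positivity
  have hq4 : q - 2 = 4 / (((m + 4 : ℕ) : ℝ) - 1) := by
    rw [hq, hm3]; push_cast; field_simp; ring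
  have hqm : (q - 2) * (m + 3) = 4 := by rw [hq4, hm3]; field_simp
  have hq2 := two_lt_of_morawetz_exponent hqm
  set A := ⨆ t ∈ Icc (0 : ℝ) T, ENNReal.ofReal (∫ x in Metric.closedBall (0 : Euc (m + 4)) b,
    (‖gradient (u t) x‖ ^ 2 + (timeDeriv (m + 4) u t x) ^ 2)) with hA
  set B := ⨆ t ∈ Icc (0 : ℝ) T, ENNReal.ofReal (((δ * T) ^ 2)⁻¹ *
    ∫ x in Metric.closedBall (0 : Euc (m + 4)) b, (u t x) ^ 2) with hB
  by_cases htop : A + B = ⊤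
  · rw [htop, ENNReal.mul_top (by simp; positivity)]
    exact le_top
  obtain ⟨hAtop, hBtop⟩ := ENNReal.add_ne_top.1 htop
  let i₀ : Fin (m + 4) := ⟨0, by omega⟩
  let W := axisSlice i₀ u
  have hW : ContDiff ℝ (⊤ : ℕ∞) W := contDiff_axisSlice i₀ hu
  have hW1 := contDiff_fderiv_apply_const hW ((1, 0) : ℝ × ℝ)
  have hW2 := contDiff_fderiv_apply_const hW ((0, 1) : ℝ × ℝ)
  have hW11 := contDiff_fderiv_apply_const hW1 ((1, 0) : ℝ × ℝ)
  have hW12 := contDiff_fderiv_apply_const hW1 ((0, 1) : ℝ × ℝ)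
  have hWt := hasDerivAt_fst_slice (hW.differentiable (by simp))
  have hWr := hasDerivAt_snd_slice (hW.differentiable (by simp))
  have hWtt := hasDerivAt_fst_slice (hW1.differentiable (by simp))
  have hWtr := hasDerivAt_snd_slice (hW1.differentiable (by simp))
  have hWrr := hasDerivAt_snd_slice (hW2.differentiable (by simp))
  have hWrt := hasDerivAt_fst_slice (hW2.differentiable (by simp))
  have hslice : ∀ {F : ℝ × ℝ → ℝ}, ContDiff ℝ (⊤ : ℕ∞) F → ∀ t, Continuous fun r => F (t, r) :=
    fun hF t => hF.continuous.comp (Continuous.prodMk_right t)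
  set σ : ℝ := ((m + 4 : ℕ) : ℝ) * volume.real (Metric.ball (0 : Euc (m + 4)) 1) with hσ
  have hσ0 : 0 < σ := by
    refine mul_pos (by positivity) (ENNReal.toReal_pos ?_ measure_ball_lt_top.ne)
    exact (Metric.measure_ball_pos volume _ one_pos).ne'
  have hE : ∀ t ∈ Icc (0 : ℝ) T, σ * (∫ r in (0 : ℝ)..b, r ^ (m + 3) *
      (fderiv ℝ W (t, r) (0, 1) ^ 2 + fderiv ℝ W (t, r) (1, 0) ^ 2)) ≤ A.toReal := by
    intro t ht
    have h1 := hslice hW1 t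
    have h2 := hslice hW2 t
    obtain ⟨hi, he⟩ := integral_closedBall_norm (m := m) hb0
      (g := fun r => fderiv ℝ W (t, r) (0, 1) ^ 2 + fderiv ℝ W (t, r) (1, 0) ^ 2)
      (h := fun r => r ^ (m + 3) *
        (fderiv ℝ W (t, r) (0, 1) ^ 2 + fderiv ℝ W (t, r) (1, 0) ^ 2))
      (by fun_prop) (fun r _ => rfl)
    have hgc := continuous_norm_gradient (contDiff_space_slice hu t)
    have htc := continuous_timeDeriv hu t
    have hgi : IntegrableOn (fun x => ‖gradient (u t) x‖ ^ 2 + (timeDeriv (m + 4) u t x) ^ 2)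
        (Metric.closedBall (0 : Euc (m + 4)) b) :=
      ContinuousOn.integrableOn_compact (isCompact_closedBall _ _)
        (Continuous.continuousOn (by fun_prop))
    have hle : ∫ x in Metric.closedBall (0 : Euc (m + 4)) b, (fderiv ℝ W (t, ‖x‖) (0, 1) ^ 2 +
        fderiv ℝ W (t, ‖x‖) (1, 0) ^ 2) ≤ ∫ x in Metric.closedBall (0 : Euc (m + 4)) b,
        (‖gradient (u t) x‖ ^ 2 + (timeDeriv (m + 4) u t x) ^ 2) := by
      refine integral_mono_ae hi hgi ?_
      have hne : ∀ᵐ x : Euc (m + 4) ∂volume, x ≠ 0 := by simp [ae_iff]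
      filter_upwards [ae_restrict_of_ae hne] with x hx
      rw [timeDeriv_eq_axisSlice i₀ hT hu hrad ht x]
      have := pow_le_pow_left₀ (abs_nonneg _)
        (abs_fderiv_axisSlice_le_norm_gradient i₀ hu (hrad t ht) hx) 2
      rw [sq_abs] at this
      exact add_le_add_left this _
    rw [← he]
    refine hle.trans ?_
    rw [← ENNReal.ofReal_le_iff_le_toReal hAtop]
    exact le_iSup₂_of_le t ht le_rfl
  have hN : ∀ t ∈ Icc (0 : ℝ) T, σ * ((b ^ 2)⁻¹ * ∫ r in (0 : ℝ)..b, r ^ (m + 3) * W (t, r) ^ 2) ≤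
      B.toReal := by
    intro t ht
    have h1 := hslice hW t
    obtain ⟨hi, he⟩ := integral_closedBall_norm (m := m) hb0 (g := fun r => W (t, r) ^ 2)
      (h := fun r => r ^ (m + 3) * W (t, r) ^ 2) (by fun_prop) (fun r _ => rfl)
    have heu : ∫ x in Metric.closedBall (0 : Euc (m + 4)) b, (u t x) ^ 2 =
        σ * ∫ r in (0 : ℝ)..b, r ^ (m + 3) * W (t, r) ^ 2 := by
      rw [← he]
      simp only [(hrad t ht).eq_axisSlice i₀, W]
    have h2 : ((δ * T) ^ 2)⁻¹ * ∫ x in Metric.closedBall (0 : Euc (m + 4)) b, (u t x) ^ 2 ≤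
        B.toReal := by
      rw [← ENNReal.ofReal_le_iff_le_toReal hBtop]
      exact le_iSup₂_of_le t ht le_rfl
    have h3 : 0 ≤ ∫ x in Metric.closedBall (0 : Euc (m + 4)) b, (u t x) ^ 2 :=
      integral_nonneg fun x => sq_nonneg _
    have h4 : (b ^ 2)⁻¹ ≤ ((δ * T) ^ 2)⁻¹ := by
      have : 0 < δ * T := by positivity
      gcongr
      rw [hb]; linarith
    calc _ = (b ^ 2)⁻¹ * ∫ x in Metric.closedBall (0 : Euc (m + 4)) b, (u t x) ^ 2 := by
          rw [heu]; ring
      _ ≤ _ := (mul_le_mul_of_nonneg_right h4 h3).trans h2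
  have hpde : ∀ t ∈ Icc (0 : ℝ) T, ∀ r, 0 < r →
      fderiv ℝ (fun p => fderiv ℝ W p (1, 0)) (t, r) (1, 0)
        - (fderiv ℝ (fun p => fderiv ℝ W p (0, 1)) (t, r) (0, 1)
          + ((m : ℝ) + 3) / r * fderiv ℝ W (t, r) (0, 1))
        + |W (t, r)| ^ (q - 2) * W (t, r) = 0 := by
    intro t ht r hr
    have h := heq t ht (r • EuclideanSpace.single i₀ 1)
    have htt : timeDeriv2 (m + 4) u t (r • EuclideanSpace.single i₀ 1) =
        fderiv ℝ (fun p => fderiv ℝ W p (1, 0)) (t, r) (1, 0) := by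
      have : deriv (fun s => u s (r • EuclideanSpace.single i₀ 1)) =
          fun s => fderiv ℝ W (s, r) (1, 0) := funext fun s => (hWt s r).deriv
      rw [timeDeriv2, this]
      exact (hWtt t r).deriv
    rw [htt, spatialLap_radial (contDiff_space_slice hu t) i₀ (hWr t) (hWrr t) (fun _ => rfl)
      ((hrad t ht).eq_axisSlice i₀) hr, ← hq4, hm3] at h
    exact h
  have hmain := radial_truncated_morawetz (S := (A + B).toReal / σ)
    (v := fun t r => W (t, r)) (w := fun t r => fderiv ℝ W (t, r) (0, 1))
    (z := fun t r => fderiv ℝ W (t, r) (1, 0))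
    (y := fun t r => fderiv ℝ (fun p => fderiv ℝ W p (1, 0)) (t, r) (1, 0))
    (x := fun t r => fderiv ℝ (fun p => fderiv ℝ W p (1, 0)) (t, r) (0, 1)) hqm hb0 hT.le hW.continuous
    hW2.continuous hW1.continuous hW11.continuous hW12.continuous hWr hWrr hWtr hWt
    (fun t r => (hWrt t r).congr_deriv (fderiv_fderiv_apply_comm hW _ _ _)) hWtt hpde
    (fun t ht => by
      rw [le_div_iff₀ hσ0, ENNReal.toReal_add hAtop hBtop]
      linarith [hE t ht, hN t ht])
  set I : ℝ → ℝ := fun t => ∫ r in (0 : ℝ)..b,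
    (1 - r / b) * (r ^ (m + 2) * |W (t, r)| ^ q + r ^ m * W (t, r) ^ 2) with hI
  have hrpow : Continuous fun p : ℝ × ℝ => |W p| ^ q :=
    hW.continuous.abs.rpow_const (fun _ => Or.inr (by linarith))
  have hWc := hW.continuous
  have hIc : Continuous I := by
    refine intervalIntegral.continuous_parametric_intervalIntegral_of_continuous' (μ := volume)
      ?_ 0 b
    simp only [Function.uncurry_def]
    fun_prop
  have hI0 : ∀ t, 0 ≤ I t := fun t => by
    refine intervalIntegral.integral_nonneg hb0.le fun r hr => ?_
    have := sub_nonneg.2 ((div_le_one hb0).2 hr.2)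
    have := hr.1
    positivity
  have hκ : (0 : ℝ) ≤ 2 * (K + 1) * σ := by positivity
  have hinner : ∀ t ∈ Icc (0 : ℝ) T, ∫⁻ x : Euc (m + 4), ENNReal.ofReal (χ ((δ * T)⁻¹ • x) *
      ((u t x) ^ 2 / ‖x‖ ^ 3 + |u t x| ^ q / ‖x‖)) ≤ ENNReal.ofReal (2 * (K + 1) * σ * I t) := by
    intro t ht
    have h1 := hslice hW t
    have h2 := hrpow.comp (Continuous.prodMk_right t)
    obtain ⟨hi, he⟩ := integral_closedBall_norm (m := m) hb0
      (g := fun r => (1 - r / b) * (W (t, r) ^ 2 / r ^ 3 + |W (t, r)| ^ q / r))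
      (h := fun r => (1 - r / b) * (r ^ (m + 2) * |W (t, r)| ^ q + r ^ m * W (t, r) ^ 2))
      (by fun_prop) (fun r hr => by field_simp; ring)
    have hpt : ∀ x : Euc (m + 4), ENNReal.ofReal (χ ((δ * T)⁻¹ • x) *
        ((u t x) ^ 2 / ‖x‖ ^ 3 + |u t x| ^ q / ‖x‖)) ≤
        (Metric.closedBall (0 : Euc (m + 4)) b).indicator (fun x => ENNReal.ofReal
          (2 * (K + 1) * ((1 - ‖x‖ / b) * (W (t, ‖x‖) ^ 2 / ‖x‖ ^ 3
            + |W (t, ‖x‖)| ^ q / ‖x‖)))) x := by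
      intro x
      have hδT : 0 < δ * T := by positivity
      have hnorm : ‖(δ * T)⁻¹ • x‖ = 2 * (‖x‖ / b) := by
        rw [norm_smul, norm_inv, Real.norm_of_nonneg hδT.le, hb]
        field_simp
      by_cases hx : ‖x‖ ≤ b
      · have hxb : ‖x‖ / b ≤ 1 := (div_le_one hb0).2 hx
        rw [indicator_of_mem (by simpa using hx), (hrad t ht).eq_axisSlice i₀ x, ← mul_assoc]
        refine ENNReal.ofReal_le_ofReal (mul_le_mul_of_nonneg_right ?_ (by positivity))
        have := le_mul_two_sub_norm (by omega) hK hχout (x := (δ * T)⁻¹ • x)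
          (by rw [hnorm]; linarith)
        rw [hnorm] at this
        nlinarith
      · have hxb : 1 ≤ ‖x‖ / b := (one_le_div hb0).2 (le_of_not_ge hx)
        rw [hχout _ (by rw [hnorm]; linarith)]
        simp
    refine (lintegral_mono hpt).trans ?_
    rw [lintegral_indicator measurableSet_closedBall, ← ofReal_integral_eq_lintegral_ofReal
      (hi.const_mul _), integral_const_mul, he]
    · refine ENNReal.ofReal_le_ofReal (le_of_eq ?_)
      ring
    · filter_upwards [ae_restrict_mem measurableSet_closedBall] with x hx
      have := sub_nonneg.2 ((div_le_one hb0).2 (by simpa using hx : ‖x‖ ≤ b))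
      simp only [Pi.zero_apply]
      positivity
  refine (setLIntegral_mono' measurableSet_Icc hinner).trans ?_
  rw [← ofReal_integral_eq_lintegral_ofReal
      ((hIc.const_mul _).integrableOn_Icc) (.of_forall fun t => mul_nonneg hκ (hI0 t)),
    integral_const_mul, integral_Icc_eq_integral_Ioc, ← intervalIntegral.integral_of_le hT.le,
    ← ENNReal.ofReal_toReal htop, ← ENNReal.ofReal_mul (by positivity)]
  refine ENNReal.ofReal_le_ofReal ((mul_le_mul_of_nonneg_left hmain hκ).trans_eq ?_)
  rw [hb]
  field_simp
  ring
end
end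

section
/- (Local energy decay) Let d ≥ 4, let χ ∈ C_0^∞(ℝ^d) satisfy 0 ≤ χ ≤ 1, χ(x) = 1 for |x| ≤ 1, and χ(x) = 0 for |x| ≥ 2, and let δ > 0. Let u be a radial classical solution of the defocusing conformal nonlinear wave equation on [0, T] × ℝ^d for some T > 0. Then there is a constant C depending only on d, δ, and χ such that for every R > 0, R^{−1} ∫_0^T ∫_{|x| ≤ R} χ(x/(δT)) [ |∇u|² + (∂_t u)² ] dx dt ≤ C ( sup_{t ∈ [0, T]} ‖∇_{t,x} u(t)‖_{L²(|x| ≤ 2δT)}² + sup_{t ∈ [0, T]} (δT)^{−2} ‖u(t)‖_{L²(|x| ≤ 2δT)}² + sup_{t ∈ [0, T]} ‖u(t)‖_{L^{2(d+1)/(d−1)}(|x| ≤ 2δT)}^{2(d+1)/(d−1)} ), where ‖∇_{t,x} u(t)‖² = ‖∇u(t)‖² + ‖∂_t u(t)‖². -/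
noncomputable section

open MeasureTheory Real Set
open scoped ENNReal RealInnerProductSpace

/-- The functions `wt`, `wr`, `wtt`, `wtr`, `wrr` are the continuous partial derivatives of the
radial profile `w` of a solution on `[0, T]` in dimension `m + 4`. -/
structure IsRadialProfile (m : ℕ) (T : ℝ) (w wt wr wtt wtr wrr : ℝ → ℝ → ℝ) : Prop where
  cont_w : Continuous fun p : ℝ × ℝ => w p.1 p.2
  cont_wt : Continuous fun p : ℝ × ℝ => wt p.1 p.2
  cont_wr : Continuous fun p : ℝ × ℝ => wr p.1 p.2
  cont_wtt : Continuous fun p : ℝ × ℝ => wtt p.1 p.2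
  cont_wtr : Continuous fun p : ℝ × ℝ => wtr p.1 p.2
  hasDerivAt_time : ∀ t r, HasDerivAt (fun t => w t r) (wt t r) t
  hasDerivAt_radius : ∀ t r, HasDerivAt (w t) (wr t r) r
  hasDerivAt_time_time : ∀ t r, HasDerivAt (fun t => wt t r) (wtt t r) t
  hasDerivAt_time_radius : ∀ t r, HasDerivAt (wt t) (wtr t r) r
  hasDerivAt_radius_time : ∀ t r, HasDerivAt (fun t => wr t r) (wtr t r) t
  hasDerivAt_radius_radius : ∀ t r, HasDerivAt (wr t) (wrr t r) r
  equation : ∀ t ∈ Icc (0 : ℝ) T, ∀ r > 0, wtt t r = wrr t r + ((m : ℝ) + 3) / r * wr t r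
    - |w t r| ^ (4 / ((m : ℝ) + 3)) * w t r

/-- The energy density of `v = r ^ ((m + 3) / 2) * w`, in terms of the values `a`, `b`, `c` of
`w`, `∂ᵣ w`, `∂ₜ w`. -/
def kineticDensity (m : ℕ) (r a b c : ℝ) : ℝ :=
  (r ^ (m + 3) * c ^ 2 + r ^ (m + 1) * (r * b + ((m : ℝ) + 3) / 2 * a) ^ 2) / 2

/-- The potential density of `v = r ^ ((m + 3) / 2) * w`, in terms of the value `a` of `w`. -/
def potentialDensity (m : ℕ) (r a : ℝ) : ℝ :=
  r ^ (m + 3) * (|a| ^ (2 + 4 / ((m : ℝ) + 3)) / (2 + 4 / ((m : ℝ) + 3)))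
    + ((m : ℝ) + 3) * ((m : ℝ) + 1) / 8 * (r ^ (m + 1) * a ^ 2)

/-- The momentum density of `v = r ^ ((m + 3) / 2) * w`. -/
def momentumDensity (m : ℕ) (r a b c : ℝ) : ℝ :=
  r ^ (m + 2) * c * (r * b + ((m : ℝ) + 3) / 2 * a)

lemma kineticDensity_nonneg (m : ℕ) {r : ℝ} (hr : 0 ≤ r) (a b c : ℝ) :
    0 ≤ kineticDensity m r a b c := by
  unfold kineticDensity; positivity

lemma potentialDensity_nonneg (m : ℕ) {r : ℝ} (hr : 0 ≤ r) (a : ℝ) :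
    0 ≤ potentialDensity m r a := by
  unfold potentialDensity; positivity

lemma abs_momentumDensity_le (m : ℕ) {r : ℝ} (hr : 0 ≤ r) (a b c : ℝ) :
    |momentumDensity m r a b c| ≤ kineticDensity m r a b c := by
  unfold momentumDensity kineticDensity
  set y := r * b + ((m : ℝ) + 3) / 2 * a
  have h1 : 0 ≤ r ^ (m + 1) * (r * c - y) ^ 2 := by positivity
  have h2 : 0 ≤ r ^ (m + 1) * (r * c + y) ^ 2 := by positivity
  have e2 : r ^ (m + 2) = r ^ (m + 1) * r := by ring
  have e3 : r ^ (m + 3) = r ^ (m + 1) * r ^ 2 := by ring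
  rw [abs_le, e2, e3]
  constructor <;> nlinarith

lemma energy_le_kineticDensity_add_potentialDensity (m : ℕ) {r : ℝ} (hr : 0 ≤ r) (a b c : ℝ) :
    r ^ (m + 3) * (b ^ 2 + c ^ 2) ≤ 12 * (kineticDensity m r a b c + potentialDensity m r a) := by
  have h0 : 0 ≤ r ^ (m + 3) * (|a| ^ (2 + 4 / ((m : ℝ) + 3)) / (2 + 4 / ((m : ℝ) + 3))) := by
    positivity
  have h1 : 0 ≤ r ^ (m + 3) * c ^ 2 := by positivity
  have h2 : (r * b) ^ 2 ≤ 6 * (r * b + ((m : ℝ) + 3) / 2 * a) ^ 2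
      + 12 * (((m : ℝ) + 3) * ((m : ℝ) + 1) / 8) * a ^ 2 := by
    have h3 : (r * b) ^ 2 ≤ 2 * (r * b + ((m : ℝ) + 3) / 2 * a) ^ 2
        + ((m : ℝ) + 3) ^ 2 / 2 * a ^ 2 := by
      nlinarith [sq_nonneg (r * b + ((m : ℝ) + 3) * a)]
    have h4 : ((m : ℝ) + 3) ^ 2 / 2 * a ^ 2
        ≤ 12 * (((m : ℝ) + 3) * ((m : ℝ) + 1) / 8) * a ^ 2 := by
      have : (0 : ℝ) ≤ m := m.cast_nonneg
      gcongr
      nlinarith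
    nlinarith [sq_nonneg (r * b + ((m : ℝ) + 3) / 2 * a)]
  have h3 := mul_le_mul_of_nonneg_left h2 (pow_nonneg hr (m + 1))
  have e3 : r ^ (m + 3) = r ^ (m + 1) * r ^ 2 := by ring
  unfold kineticDensity potentialDensity
  nlinarith

lemma hasDerivAt_div_add_abs {R r : ℝ} (hR : 0 < R) (hr : 0 < r) :
    HasDerivAt (fun r => r / (R + |r|)) (R / (R + |r|) ^ 2) r := by
  have h := (hasDerivAt_id r).div ((hasDerivAt_abs_pos hr).const_add R)
    (by positivity : R + |r| ≠ 0)
  refine h.congr_deriv ?_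
  simp [abs_of_pos hr]

namespace IsRadialProfile

variable {m : ℕ} {T : ℝ} {w wt wr wtt wtr wrr : ℝ → ℝ → ℝ}

lemma continuous_kineticDensity (h : IsRadialProfile m T w wt wr wtt wtr wrr) :
    Continuous fun p : ℝ × ℝ =>
      kineticDensity m p.2 (w p.1 p.2) (wr p.1 p.2) (wt p.1 p.2) := by
  have := h.cont_w; have := h.cont_wr; have := h.cont_wt
  unfold kineticDensity
  fun_prop

lemma continuous_potentialDensity (h : IsRadialProfile m T w wt wr wtt wtr wrr) :
    Continuous fun p : ℝ × ℝ => potentialDensity m p.2 (w p.1 p.2) := by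
  have := h.cont_w
  unfold potentialDensity
  have hc : Continuous fun p : ℝ × ℝ => |w p.1 p.2| ^ (2 + 4 / ((m : ℝ) + 3)) :=
    this.abs.rpow_const fun _ => Or.inr (by positivity)
  fun_prop

lemma continuous_momentumDensity (h : IsRadialProfile m T w wt wr wtt wtr wrr) :
    Continuous fun p : ℝ × ℝ =>
      momentumDensity m p.2 (w p.1 p.2) (wr p.1 p.2) (wt p.1 p.2) := by
  have := h.cont_w; have := h.cont_wr; have := h.cont_wt
  unfold momentumDensity
  fun_prop

lemma hasDerivAt_momentumDensity (h : IsRadialProfile m T w wt wr wtt wtr wrr) (t r : ℝ) :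
    HasDerivAt (fun t => momentumDensity m r (w t r) (wr t r) (wt t r))
      (r ^ (m + 2) * (wtt t r * (r * wr t r + ((m : ℝ) + 3) / 2 * w t r)
        + wt t r * (r * wtr t r + ((m : ℝ) + 3) / 2 * wt t r))) t := by
  have h1 := (((h.hasDerivAt_time_time t r).const_mul (r ^ (m + 2))).mul
    (((h.hasDerivAt_radius_time t r).const_mul r).add
      ((h.hasDerivAt_time t r).const_mul (((m : ℝ) + 3) / 2))))
  refine h1.congr_deriv ?_
  simp only [Pi.add_apply]
  ring

lemma hasDerivAt_potentialDensity (h : IsRadialProfile m T w wt wr wtt wtr wrr) (t r : ℝ) :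
    HasDerivAt (fun r => potentialDensity m r (w t r))
      ((m + 3) * r ^ (m + 2) * (|w t r| ^ (2 + 4 / ((m : ℝ) + 3)) / (2 + 4 / ((m : ℝ) + 3)))
        + r ^ (m + 3) * (|w t r| ^ (4 / ((m : ℝ) + 3)) * w t r * wr t r)
        + ((m : ℝ) + 3) * ((m : ℝ) + 1) / 8
          * ((m + 1) * r ^ m * w t r ^ 2 + r ^ (m + 1) * (2 * w t r * wr t r))) r := by
  have hq : 1 < 2 + 4 / ((m : ℝ) + 3) := by
    have : 0 < 4 / ((m : ℝ) + 3) := by positivity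
    linarith
  have h0 := h.hasDerivAt_radius t r
  have h1 := ((hasDerivAt_abs_rpow (w t r) hq).comp r h0).div_const (2 + 4 / ((m : ℝ) + 3))
  have h2 := ((hasDerivAt_pow (m + 3) r).mul h1).add
    (((hasDerivAt_pow (m + 1) r).mul (h0.pow 2)).const_mul (((m : ℝ) + 3) * ((m : ℝ) + 1) / 8))
  refine h2.congr_deriv ?_
  have hq0 : 2 + 4 / ((m : ℝ) + 3) ≠ 0 := by positivity
  rw [show 2 + 4 / ((m : ℝ) + 3) - 2 = 4 / ((m : ℝ) + 3) by ring]
  simp only [Function.comp_def, Nat.add_sub_cancel, Nat.cast_add, Nat.cast_ofNat, Nat.cast_one,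
    show m + 3 - 1 = m + 2 by lia, Pi.pow_apply]
  generalize 2 + 4 / ((m : ℝ) + 3) = q at *
  field_simp
  ring

lemma hasDerivAt_kineticDensity (h : IsRadialProfile m T w wt wr wtt wtr wrr) (t r : ℝ) :
    HasDerivAt (fun r => kineticDensity m r (w t r) (wr t r) (wt t r))
      (((m + 3) * r ^ (m + 2) * wt t r ^ 2 + r ^ (m + 3) * (2 * wt t r * wtr t r)
        + (m + 1) * r ^ m * (r * wr t r + ((m : ℝ) + 3) / 2 * w t r) ^ 2
        + r ^ (m + 1) * (2 * (r * wr t r + ((m : ℝ) + 3) / 2 * w t r)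
          * (wr t r + r * wrr t r + ((m : ℝ) + 3) / 2 * wr t r))) / 2) r := by
  have h0 := h.hasDerivAt_radius t r
  have hy := ((hasDerivAt_id r).mul (h.hasDerivAt_radius_radius t r)).add
    (h0.const_mul (((m : ℝ) + 3) / 2))
  have h2 := (((hasDerivAt_pow (m + 3) r).mul ((h.hasDerivAt_time_radius t r).pow 2)).add
    ((hasDerivAt_pow (m + 1) r).mul (hy.pow 2))).div_const 2
  refine h2.congr_deriv ?_
  simp only [Nat.add_sub_cancel, Nat.cast_add, Nat.cast_ofNat, Nat.cast_one,
    show m + 3 - 1 = m + 2 by lia, Pi.add_apply, Pi.mul_apply, Pi.pow_apply, id]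
  ring

/-- The Morawetz identity with multiplier `r / (R + r)`, pointwise. -/
lemma hasDerivAt_flux (h : IsRadialProfile m T w wt wr wtt wtr wrr) {R t r : ℝ} (hR : 0 < R)
    (ht : t ∈ Icc 0 T) (hr : 0 < r) :
    HasDerivAt (fun r => r / (R + |r|) * (kineticDensity m r (w t r) (wr t r) (wt t r)
        - potentialDensity m r (w t r)))
      (r / (R + |r|) * (r ^ (m + 2) * (wtt t r * (r * wr t r + ((m : ℝ) + 3) / 2 * w t r)
        + wt t r * (r * wtr t r + ((m : ℝ) + 3) / 2 * wt t r)))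
        + (R / (R + |r|) ^ 2 * kineticDensity m r (w t r) (wr t r) (wt t r)
          + (R + 2 * |r|) / (R + |r|) ^ 2 * potentialDensity m r (w t r))) r := by
  have h1 := (hasDerivAt_div_add_abs hR hr).mul
    ((h.hasDerivAt_kineticDensity t r).sub (h.hasDerivAt_potentialDensity t r))
  refine h1.congr_deriv ?_
  rw [h.equation t ht r hr, abs_of_pos hr]
  have hq : |w t r| ^ (2 + 4 / ((m : ℝ) + 3)) = |w t r| ^ (4 / ((m : ℝ) + 3)) * w t r ^ 2 := by
    rw [add_comm, rpow_add_of_nonneg (abs_nonneg _) (by positivity) (by norm_num)]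
    norm_num
  simp only [kineticDensity, potentialDensity, Pi.sub_apply]
  rw [hq]
  have e : 2 + 4 / ((m : ℝ) + 3) ≠ 0 := by positivity
  generalize |w t r| ^ (4 / ((m : ℝ) + 3)) = F
  have : R + r ≠ 0 := by positivity
  have hm : (m : ℝ) + 3 ≠ 0 := by positivity
  have hm5 : 2 * ((m : ℝ) + 3) + 4 ≠ 0 := by positivity
  field_simp
  ring

end IsRadialProfile

lemma intervalIntegral_swap_of_continuous {f : ℝ → ℝ → ℝ}
    (hf : Continuous fun p : ℝ × ℝ => f p.1 p.2) (a b c d : ℝ) :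
    ∫ x in a..b, ∫ y in c..d, f x y = ∫ y in c..d, ∫ x in a..b, f x y := by
  refine intervalIntegral_intervalIntegral_swap ?_
  refine IntegrableOn.mono_set ?_ (Set.prod_mono uIoc_subset_uIcc uIoc_subset_uIcc)
  exact ContinuousOn.integrableOn_compact (isCompact_uIcc.prod isCompact_uIcc) hf.continuousOn

lemma energy_le_weighted_density (m : ℕ) {R r : ℝ} (hR : 0 < R) (hr : 0 ≤ r) (hrR : r ≤ R)
    (a b c : ℝ) :
    r ^ (m + 3) * (b ^ 2 + c ^ 2) ≤ 48 * R * (R / (R + |r|) ^ 2 * kineticDensity m r a b c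
      + (R + 2 * |r|) / (R + |r|) ^ 2 * potentialDensity m r a) := by
  have hk := kineticDensity_nonneg m hr a b c
  have hp := potentialDensity_nonneg m hr a
  have h := energy_le_kineticDensity_add_potentialDensity m hr a b c
  rw [abs_of_nonneg hr]
  have h1 : 1 ≤ 4 * R * (R / (R + r) ^ 2) := by
    rw [← mul_div_assoc, le_div_iff₀ (by positivity)]
    nlinarith
  have h2 : 1 ≤ 4 * R * ((R + 2 * r) / (R + r) ^ 2) := by
    rw [← mul_div_assoc, le_div_iff₀ (by positivity)]
    nlinarith
  have h3 := mul_le_mul_of_nonneg_right h1 hk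
  have h4 := mul_le_mul_of_nonneg_right h2 hp
  linarith

namespace IsRadialProfile

variable {m : ℕ} {T : ℝ} {w wt wr wtt wtr wrr : ℝ → ℝ → ℝ}

/-- The Morawetz estimate on the truncated cylinder `[0, T] × {r ≤ s}`. -/
lemma integral_energy_le_boundary_terms (h : IsRadialProfile m T w wt wr wtt wtr wrr) (hT : 0 ≤ T)
    {R s : ℝ} (hR : 0 < R) (hRs : R ≤ s) :
    ∫ t in (0 : ℝ)..T, ∫ r in (0 : ℝ)..R, r ^ (m + 3) * (wr t r ^ 2 + wt t r ^ 2)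
      ≤ 48 * R * ((∫ t in (0 : ℝ)..T, kineticDensity m s (w t s) (wr t s) (wt t s))
        + ((∫ r in (0 : ℝ)..s, kineticDensity m r (w T r) (wr T r) (wt T r))
          + ∫ r in (0 : ℝ)..s, kineticDensity m r (w 0 r) (wr 0 r) (wt 0 r))) := by
  have hs : 0 ≤ s := hR.le.trans hRs
  have := h.cont_w; have := h.cont_wr; have := h.cont_wt; have := h.cont_wtr; have := h.cont_wtt
  have hKc := h.continuous_kineticDensity
  have hVc := h.continuous_potentialDensity
  have hMc := h.continuous_momentumDensity
  set K : ℝ → ℝ → ℝ := fun t r => kineticDensity m r (w t r) (wr t r) (wt t r)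
  set V : ℝ → ℝ → ℝ := fun t r => potentialDensity m r (w t r)
  set M : ℝ → ℝ → ℝ := fun t r => momentumDensity m r (w t r) (wr t r) (wt t r)
  change Continuous fun p : ℝ × ℝ => K p.1 p.2 at hKc
  change Continuous fun p : ℝ × ℝ => V p.1 p.2 at hVc
  change Continuous fun p : ℝ × ℝ => M p.1 p.2 at hMc
  set M' : ℝ → ℝ → ℝ := fun t r =>
    r ^ (m + 2) * (wtt t r * (r * wr t r + ((m : ℝ) + 3) / 2 * w t r)
        + wt t r * (r * wtr t r + ((m : ℝ) + 3) / 2 * wt t r))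
  have hM'c : Continuous fun p : ℝ × ℝ => M' p.1 p.2 := by fun_prop
  set W : ℝ → ℝ → ℝ := fun t r => R / (R + |r|) ^ 2 * K t r + (R + 2 * |r|) / (R + |r|) ^ 2 * V t r
  have hWc : Continuous fun p : ℝ × ℝ => W p.1 p.2 := by
    simp only [W]
    fun_prop (disch := intro p; positivity)
  have hAM'c : Continuous fun p : ℝ × ℝ => p.2 / (R + |p.2|) * M' p.1 p.2 := by
    fun_prop (disch := intro p; positivity)
  have hAMc : Continuous fun p : ℝ × ℝ => p.2 / (R + |p.2|) * M p.1 p.2 := by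
    fun_prop (disch := intro p; positivity)
  have hQc : Continuous fun p : ℝ × ℝ => p.2 / (R + |p.2|) * (K p.1 p.2 - V p.1 p.2) := by
    fun_prop (disch := intro p; positivity)
  have hK0 : ∀ t r, 0 ≤ r → 0 ≤ K t r := fun t r hr => kineticDensity_nonneg m hr _ _ _
  have hV0 : ∀ t r, 0 ≤ r → 0 ≤ V t r := fun t r hr => potentialDensity_nonneg m hr _
  have hW0 : ∀ t r, 0 ≤ r → 0 ≤ W t r := fun t r hr => by
    have := hK0 t r hr; have := hV0 t r hr
    simp only [W]; positivity
  have hA0 : ∀ r : ℝ, 0 ≤ r → 0 ≤ r / (R + |r|) := fun r hr => by positivity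
  have hA1 : ∀ r : ℝ, 0 ≤ r → r / (R + |r|) ≤ 1 := fun r hr => by
    rw [abs_of_nonneg hr]; exact div_le_one_of_le₀ (by linarith) (by positivity)
  have slice : ∀ {f : ℝ → ℝ → ℝ}, (Continuous fun p : ℝ × ℝ => f p.1 p.2) → ∀ t,
      Continuous (f t) := fun hf t => hf.comp (Continuous.prodMk_right t)
  have slice' : ∀ {f : ℝ → ℝ → ℝ}, (Continuous fun p : ℝ × ℝ => f p.1 p.2) → ∀ r,
      Continuous (fun t => f t r) := fun hf r => hf.comp (Continuous.prodMk_left r)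
  have integ : ∀ {f : ℝ → ℝ → ℝ}, (Continuous fun p : ℝ × ℝ => f p.1 p.2) → ∀ b,
      Continuous fun t => ∫ r in (0 : ℝ)..b, f t r := fun hf b =>
    intervalIntegral.continuous_parametric_intervalIntegral_of_continuous' hf 0 b
  have flux : ∀ t ∈ Icc 0 T, (∫ r in (0 : ℝ)..s, r / (R + |r|) * M' t r) + ∫ r in (0 : ℝ)..s, W t r
      = s / (R + |s|) * (K t s - V t s) := by
    intro t ht
    have c1 : Continuous fun r => r / (R + |r|) * M' t r := hAM'c.comp (Continuous.prodMk_right t)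
    have c2 : Continuous fun r => r / (R + |r|) * (K t r - V t r) :=
      hQc.comp (Continuous.prodMk_right t)
    rw [← intervalIntegral.integral_add (c1.intervalIntegrable _ _)
      ((slice hWc t).intervalIntegrable _ _),
      intervalIntegral.integral_eq_sub_of_hasDerivAt_of_le hs
        (f := fun r => r / (R + |r|) * (K t r - V t r)) c2.continuousOn
        (fun r hr => h.hasDerivAt_flux hR ht hr.1)
        ((c1.add (slice hWc t)).intervalIntegrable _ _)]
    simp
  have time : ∫ t in (0 : ℝ)..T, ∫ r in (0 : ℝ)..s, r / (R + |r|) * M' t r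
      = ∫ r in (0 : ℝ)..s, r / (R + |r|) * (M T r - M 0 r) := by
    rw [intervalIntegral_swap_of_continuous (f := fun t r => r / (R + |r|) * M' t r) hAM'c]
    refine intervalIntegral.integral_congr fun r _ => ?_
    rw [intervalIntegral.integral_const_mul]
    congr 1
    exact intervalIntegral.integral_eq_sub_of_hasDerivAt
      (fun t _ => h.hasDerivAt_momentumDensity t r) ((slice' hM'c r).intervalIntegrable _ _)
  have total : (∫ r in (0 : ℝ)..s, r / (R + |r|) * (M T r - M 0 r))
      + ∫ t in (0 : ℝ)..T, ∫ r in (0 : ℝ)..s, W t r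
      = ∫ t in (0 : ℝ)..T, s / (R + |s|) * (K t s - V t s) := by
    have c1 : Continuous fun t => ∫ r in (0 : ℝ)..s, r / (R + |r|) * M' t r :=
      integ (f := fun t r => r / (R + |r|) * M' t r) hAM'c s
    rw [← time, ← intervalIntegral.integral_add (c1.intervalIntegrable _ _)
      ((integ hWc s).intervalIntegrable _ _)]
    refine intervalIntegral.integral_congr fun t ht => flux t ?_
    rwa [uIcc_of_le hT] at ht
  have lower : -((∫ r in (0 : ℝ)..s, K T r) + ∫ r in (0 : ℝ)..s, K 0 r)
      ≤ ∫ r in (0 : ℝ)..s, r / (R + |r|) * (M T r - M 0 r) := by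
    rw [← intervalIntegral.integral_add ((slice hKc T).intervalIntegrable _ _)
      ((slice hKc 0).intervalIntegrable _ _), ← intervalIntegral.integral_neg]
    have c1 : Continuous fun r => r / (R + |r|) * (M T r - M 0 r) := by
      simp only [mul_sub]
      exact (hAMc.comp (Continuous.prodMk_right T)).sub (hAMc.comp (Continuous.prodMk_right 0))
    refine intervalIntegral.integral_mono_on hs
      (((slice hKc T).add (slice hKc 0)).neg.intervalIntegrable _ _)
      (c1.intervalIntegrable _ _) ?_
    intro r hr
    have b1 := abs_le.1 (abs_momentumDensity_le m hr.1 (w T r) (wr T r) (wt T r))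
    have b2 := abs_le.1 (abs_momentumDensity_le m hr.1 (w 0 r) (wr 0 r) (wt 0 r))
    have b3 : |M T r - M 0 r| ≤ K T r + K 0 r := by
      rw [abs_le]; constructor <;> simp only [M, K] <;> linarith
    have b4 : |r / (R + |r|) * (M T r - M 0 r)| ≤ K T r + K 0 r := by
      rw [abs_mul, abs_of_nonneg (hA0 r hr.1)]
      exact (mul_le_of_le_one_left (abs_nonneg _) (hA1 r hr.1)).trans b3
    exact (abs_le.1 b4).1
  have upper : ∫ t in (0 : ℝ)..T, s / (R + |s|) * (K t s - V t s) ≤ ∫ t in (0 : ℝ)..T, K t s := by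
    have c1 : Continuous fun t => s / (R + |s|) * (K t s - V t s) :=
      hQc.comp (Continuous.prodMk_left s)
    refine intervalIntegral.integral_mono_on hT (c1.intervalIntegrable _ _)
      ((slice' hKc s).intervalIntegrable _ _) fun t _ => ?_
    have hK := hK0 t s hs; have hV := hV0 t s hs
    calc s / (R + |s|) * (K t s - V t s) ≤ s / (R + |s|) * K t s := by
          refine mul_le_mul_of_nonneg_left ?_ (hA0 s hs)
          linarith
      _ ≤ K t s := mul_le_of_le_one_left hK (hA1 s hs)
  have inner : ∫ t in (0 : ℝ)..T, ∫ r in (0 : ℝ)..R, r ^ (m + 3) * (wr t r ^ 2 + wt t r ^ 2)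
      ≤ ∫ t in (0 : ℝ)..T, 48 * R * ∫ r in (0 : ℝ)..s, W t r := by
    have hec : Continuous fun p : ℝ × ℝ => p.2 ^ (m + 3) * (wr p.1 p.2 ^ 2 + wt p.1 p.2 ^ 2) := by
      fun_prop
    have c1 : Continuous fun t => ∫ r in (0 : ℝ)..R, r ^ (m + 3) * (wr t r ^ 2 + wt t r ^ 2) :=
      integ (f := fun t r => r ^ (m + 3) * (wr t r ^ 2 + wt t r ^ 2)) hec R
    have c2 : ∀ t, Continuous fun r => r ^ (m + 3) * (wr t r ^ 2 + wt t r ^ 2) := fun t =>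
      hec.comp (Continuous.prodMk_right t)
    refine intervalIntegral.integral_mono_on hT (c1.intervalIntegrable _ _)
      ((continuous_const.mul (integ hWc s)).intervalIntegrable _ _) fun t _ => ?_
    calc _ ≤ ∫ r in (0 : ℝ)..R, 48 * R * W t r :=
          intervalIntegral.integral_mono_on hR.le ((c2 t).intervalIntegrable _ _)
            ((continuous_const.mul (slice hWc t)).intervalIntegrable _ _)
            fun r hr => energy_le_weighted_density m hR hr.1 hr.2 _ _ _
      _ = 48 * R * ∫ r in (0 : ℝ)..R, W t r := intervalIntegral.integral_const_mul _ _
      _ ≤ 48 * R * ∫ r in (0 : ℝ)..s, W t r := by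
          refine mul_le_mul_of_nonneg_left ?_ (by positivity)
          refine intervalIntegral.integral_mono_interval le_rfl hR.le hRs ?_
            ((slice hWc t).intervalIntegrable _ _)
          filter_upwards [ae_restrict_mem measurableSet_Ioc] with r hr using hW0 t r hr.1.le
  rw [intervalIntegral.integral_const_mul] at inner
  refine inner.trans (mul_le_mul_of_nonneg_left ?_ (by positivity))
  linarith

/-- Averaging the Morawetz estimate over the lateral boundary. -/
lemma integral_energy_le_of_kineticDensity_le (h : IsRadialProfile m T w wt wr wtt wtr wrr)
    (hT : 0 ≤ T) {R L H : ℝ} (hR : 0 < R) (hRL : R ≤ L)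
    (hH : ∀ t ∈ Icc 0 T,
      ∫ r in (0 : ℝ)..2 * L, kineticDensity m r (w t r) (wr t r) (wt t r) ≤ H) :
    ∫ t in (0 : ℝ)..T, ∫ r in (0 : ℝ)..R, r ^ (m + 3) * (wr t r ^ 2 + wt t r ^ 2)
      ≤ 48 * R * ((T / L + 2) * H) := by
  have hL : 0 < L := hR.trans_le hRL
  have hKc := h.continuous_kineticDensity
  set K : ℝ → ℝ → ℝ := fun t r => kineticDensity m r (w t r) (wr t r) (wt t r)
  change Continuous fun p : ℝ × ℝ => K p.1 p.2 at hKc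
  have hK0 : ∀ t r, 0 ≤ r → 0 ≤ K t r := fun t r hr => kineticDensity_nonneg m hr _ _ _
  have slice : ∀ t, Continuous (K t) := fun t => hKc.comp (Continuous.prodMk_right t)
  have hKc' : Continuous fun p : ℝ × ℝ => K p.2 p.1 := hKc.comp continuous_swap
  have mono : ∀ t ∈ Icc 0 T, ∀ a b, 0 ≤ a → a ≤ b → b ≤ 2 * L → ∫ r in a..b, K t r ≤ H := by
    intro t ht a b ha hab hb
    refine (intervalIntegral.integral_mono_interval ha hab hb ?_
      ((slice t).intervalIntegrable _ _)).trans (hH t ht)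
    filter_upwards [ae_restrict_mem measurableSet_Ioc] with r hr using hK0 t r hr.1.le
  set X := ∫ t in (0 : ℝ)..T, ∫ r in (0 : ℝ)..R, r ^ (m + 3) * (wr t r ^ 2 + wt t r ^ 2)
  have bound : ∀ s ∈ Icc L (2 * L), X ≤ 48 * R * ((∫ t in (0 : ℝ)..T, K t s) + 2 * H) := by
    intro s hs
    refine (h.integral_energy_le_boundary_terms hT hR (hRL.trans hs.1)).trans ?_
    have h1 := mono T ⟨hT, le_rfl⟩ 0 s le_rfl (hL.le.trans hs.1) hs.2
    have h2 := mono 0 ⟨le_rfl, hT⟩ 0 s le_rfl (hL.le.trans hs.1) hs.2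
    refine mul_le_mul_of_nonneg_left ?_ (by positivity)
    simp only [K] at h1 h2 ⊢
    linarith
  have hc : Continuous fun s => ∫ t in (0 : ℝ)..T, K t s :=
    intervalIntegral.continuous_parametric_intervalIntegral_of_continuous' hKc' 0 T
  have hc' : Continuous fun s => 48 * R * ((∫ t in (0 : ℝ)..T, K t s) + 2 * H) := by fun_prop
  have avg := intervalIntegral.integral_mono_on (by linarith : L ≤ 2 * L)
    (intervalIntegrable_const (μ := volume)) (hc'.intervalIntegrable _ _) bound
  rw [intervalIntegral.integral_const, intervalIntegral.integral_const_mul,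
    intervalIntegral.integral_add (hc.intervalIntegrable _ _)
      (continuous_const.intervalIntegrable _ _), intervalIntegral.integral_const,
    intervalIntegral_swap_of_continuous (f := fun s t => K t s) hKc', smul_eq_mul,
    smul_eq_mul] at avg
  have hc2 : Continuous fun t => ∫ r in L..2 * L, K t r :=
    intervalIntegral.continuous_parametric_intervalIntegral_of_continuous' hKc _ _
  have side : ∫ t in (0 : ℝ)..T, ∫ r in L..2 * L, K t r ≤ ∫ _t in (0 : ℝ)..T, H :=
    intervalIntegral.integral_mono_on hT (hc2.intervalIntegrable _ _)
      (continuous_const.intervalIntegrable _ _)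
      fun t ht => mono t ht L (2 * L) hL.le (by linarith) le_rfl
  rw [intervalIntegral.integral_const, smul_eq_mul] at side
  have fin : L * X ≤ 48 * R * (T * H + L * (2 * H)) := by
    refine le_trans (by linarith) (avg.trans (mul_le_mul_of_nonneg_left ?_ (by positivity)))
    linarith
  refine le_of_mul_le_mul_left (fin.trans_eq ?_) hL
  field_simp

end IsRadialProfile

/-- Hardy's inequality on a bounded interval. -/
lemma hardy_interval (m : ℕ) {L : ℝ} (hL : 0 < L) {f f' : ℝ → ℝ}
    (hf : ∀ r, HasDerivAt f (f' r) r) (hf' : Continuous f') :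
    ∫ r in (0 : ℝ)..2 * L, r ^ (m + 1) * f r ^ 2
      ≤ 2 * (∫ r in (0 : ℝ)..2 * L, r ^ (m + 3) * f' r ^ 2)
        + (L ^ 2)⁻¹ * ∫ r in (0 : ℝ)..2 * L, r ^ (m + 3) * f r ^ 2 := by
  have hfc : Continuous f := continuous_iff_continuousAt.2 fun r => (hf r).continuousAt
  have hL2 : 0 ≤ 2 * L := by linarith
  set D : ℝ → ℝ := fun r => ((m + 2) * r ^ (m + 1) * (1 - r / (2 * L))
    - r ^ (m + 2) / (2 * L)) * f r ^ 2
    + r ^ (m + 2) * (1 - r / (2 * L)) * (2 * f r * f' r) with hD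
  have hDc : Continuous D := by fun_prop
  have hderiv : ∀ r, HasDerivAt (fun r => r ^ (m + 2) * (1 - r / (2 * L)) * f r ^ 2) (D r) r := by
    intro r
    have h1 := ((hasDerivAt_pow (m + 2) r).mul
      (((hasDerivAt_id r).div_const (2 * L)).const_sub 1)).mul ((hf r).pow 2)
    refine h1.congr_deriv ?_
    simp only [hD, Nat.cast_add, Nat.cast_ofNat, show m + 2 - 1 = m + 1 by lia, Pi.mul_apply,
      Pi.pow_apply, id]
    ring
  have hint : ∫ r in (0 : ℝ)..2 * L, D r = 0 := by
    rw [intervalIntegral.integral_eq_sub_of_hasDerivAt (fun r _ => hderiv r)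
      (hDc.intervalIntegrable _ _)]
    simp [hL.ne']
  have c3 : Continuous fun r => r ^ (m + 1) * f r ^ 2 := by fun_prop
  have key : ∀ r ∈ Icc 0 (2 * L), r ^ (m + 1) * f r ^ 2 ≤
      2 * D r + (2 * (r ^ (m + 3) * f' r ^ 2) + (L ^ 2)⁻¹ * (r ^ (m + 3) * f r ^ 2)) := by
    intro r hr
    obtain ⟨x, rfl⟩ : ∃ x, r = L * x := ⟨r / L, by field_simp⟩
    have hx0 : 0 ≤ x := nonneg_of_mul_nonneg_right hr.1 hL
    have hx2 : x ≤ 2 := le_of_mul_le_mul_left (by linarith [hr.2]) hL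
    have hφ : 0 ≤ 1 - x / 2 := by linarith
    have hp : 0 ≤ (L * x) ^ (m + 1) := pow_nonneg hr.1 _
    have hmain : f (L * x) ^ 2 ≤ 2 * (((m + 2) * (1 - x / 2) - x / 2) * f (L * x) ^ 2
        + (1 - x / 2) * (2 * f (L * x) * (L * x * f' (L * x))))
        + (2 * (L * x * f' (L * x)) ^ 2 + x ^ 2 * f (L * x) ^ 2) := by
      generalize f (L * x) = a
      generalize L * x * f' (L * x) = b
      have hm : (0 : ℝ) ≤ m := m.cast_nonneg
      have q1 : 0 ≤ (1 - x / 2) * (a + b) ^ 2 := by positivity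
      have q2 : 0 ≤ m * (1 - x / 2) * a ^ 2 := by positivity
      have q3 : 0 ≤ x / 2 * b ^ 2 := by positivity
      have q4 : 0 ≤ (1 - x) ^ 2 * a ^ 2 := by positivity
      nlinarith
    have := mul_le_mul_of_nonneg_left hmain hp
    refine this.trans_eq ?_
    simp only [hD]
    field_simp
    ring
  have c4 : Continuous fun r =>
      2 * (r ^ (m + 3) * f' r ^ 2) + (L ^ 2)⁻¹ * (r ^ (m + 3) * f r ^ 2) := by fun_prop
  have c5 : Continuous fun r => 2 * D r := by fun_prop
  have c6 : Continuous fun r => 2 * (r ^ (m + 3) * f' r ^ 2) := by fun_prop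
  have c7 : Continuous fun r => (L ^ 2)⁻¹ * (r ^ (m + 3) * f r ^ 2) := by fun_prop
  have res := intervalIntegral.integral_mono_on (μ := volume) hL2 (c3.intervalIntegrable _ _)
    ((c5.add c4).intervalIntegrable _ _) key
  simp only [Pi.add_apply] at res
  rw [intervalIntegral.integral_add (c5.intervalIntegrable _ _)
    (c4.intervalIntegrable _ _), intervalIntegral.integral_const_mul, hint,
    intervalIntegral.integral_add (c6.intervalIntegrable _ _) (c7.intervalIntegrable _ _),
    intervalIntegral.integral_const_mul, intervalIntegral.integral_const_mul] at res
  linarith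

lemma integral_kineticDensity_le (m : ℕ) {L : ℝ} (hL : 0 < L) {f f' g : ℝ → ℝ}
    (hf : ∀ r, HasDerivAt f (f' r) r) (hf' : Continuous f') (hg : Continuous g) :
    ∫ r in (0 : ℝ)..2 * L, kineticDensity m r (f r) (f' r) (g r)
      ≤ (1 + ((m : ℝ) + 3) ^ 2 / 2) *
        ((∫ r in (0 : ℝ)..2 * L, r ^ (m + 3) * (f' r ^ 2 + g r ^ 2))
        + (L ^ 2)⁻¹ * ∫ r in (0 : ℝ)..2 * L, r ^ (m + 3) * f r ^ 2) := by
  have hfc : Continuous f := continuous_iff_continuousAt.2 fun r => (hf r).continuousAt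
  have hL2 : 0 ≤ 2 * L := by linarith
  have c1 : Continuous fun r => r ^ (m + 3) * (f' r ^ 2 + g r ^ 2) := by fun_prop
  have c2 : Continuous fun r => r ^ (m + 3) * f' r ^ 2 := by fun_prop
  have c3 : Continuous fun r => r ^ (m + 1) * f r ^ 2 := by fun_prop
  have c4 : Continuous fun r => kineticDensity m r (f r) (f' r) (g r) := by
    unfold kineticDensity; fun_prop
  have c5 : Continuous fun r => ((m : ℝ) + 3) ^ 2 / 4 * (r ^ (m + 1) * f r ^ 2) := by fun_prop
  have step : ∫ r in (0 : ℝ)..2 * L, kineticDensity m r (f r) (f' r) (g r)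
      ≤ ∫ r in (0 : ℝ)..2 * L, (r ^ (m + 3) * (f' r ^ 2 + g r ^ 2)
        + ((m : ℝ) + 3) ^ 2 / 4 * (r ^ (m + 1) * f r ^ 2)) := by
    refine intervalIntegral.integral_mono_on hL2 (c4.intervalIntegrable _ _)
      ((c1.add c5).intervalIntegrable _ _) fun r hr => ?_
    have hy : (r * f' r + ((m : ℝ) + 3) / 2 * f r) ^ 2
        ≤ 2 * (r * f' r) ^ 2 + ((m : ℝ) + 3) ^ 2 / 2 * f r ^ 2 := by
      nlinarith [sq_nonneg (r * f' r - ((m : ℝ) + 3) / 2 * f r)]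
    have h1 := mul_le_mul_of_nonneg_left hy (pow_nonneg hr.1 (m + 1))
    have h2 : 0 ≤ r ^ (m + 3) * g r ^ 2 := mul_nonneg (pow_nonneg hr.1 _) (sq_nonneg _)
    have e3 : r ^ (m + 3) = r ^ (m + 1) * r ^ 2 := by ring
    unfold kineticDensity
    nlinarith
  rw [intervalIntegral.integral_add (c1.intervalIntegrable _ _) (c5.intervalIntegrable _ _),
    intervalIntegral.integral_const_mul] at step
  have hardy := hardy_interval m hL hf hf'
  have hle : ∫ r in (0 : ℝ)..2 * L, r ^ (m + 3) * f' r ^ 2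
      ≤ ∫ r in (0 : ℝ)..2 * L, r ^ (m + 3) * (f' r ^ 2 + g r ^ 2) := by
    refine intervalIntegral.integral_mono_on hL2 (c2.intervalIntegrable _ _)
      (c1.intervalIntegrable _ _) fun r hr => ?_
    exact mul_le_mul_of_nonneg_left (by nlinarith [sq_nonneg (g r)]) (pow_nonneg hr.1 _)
  have hB : 0 ≤ (L ^ 2)⁻¹ * ∫ r in (0 : ℝ)..2 * L, r ^ (m + 3) * f r ^ 2 :=
    mul_nonneg (by positivity) (intervalIntegral.integral_nonneg hL2
      fun r hr => mul_nonneg (pow_nonneg hr.1 _) (sq_nonneg _))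
  have hc : 0 ≤ ((m : ℝ) + 3) ^ 2 / 4 := by positivity
  have := mul_le_mul_of_nonneg_left hardy hc
  nlinarith [mul_le_mul_of_nonneg_left hle hc, mul_nonneg hc hB]

lemma hasFDerivAt_norm_of_ne_zero {E : Type*} [NormedAddCommGroup E] [InnerProductSpace ℝ E]
    {x : E} (hx : x ≠ 0) : HasFDerivAt (fun y : E => ‖y‖) (‖x‖⁻¹ • innerSL ℝ x) x := by
  have h := (hasStrictFDerivAt_norm_sq x).hasFDerivAt.sqrt (by positivity)
  simp only [sqrt_sq (norm_nonneg _)] at h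
  convert! h using 1
  ext y
  simp
  field_simp

lemma norm_gradient_radial {d : ℕ} {g : ℝ → ℝ} {g' : ℝ} {x : Euc d} (hx : x ≠ 0)
    (hg : HasDerivAt g g' ‖x‖) : ‖gradient (fun y : Euc d => g ‖y‖) x‖ = |g'| := by
  have h := hg.comp_hasFDerivAt x (hasFDerivAt_norm_of_ne_zero hx)
  have h' : HasFDerivAt (fun y : Euc d => g ‖y‖) (g' • ‖x‖⁻¹ • innerSL ℝ x) x := h
  rw [gradient, h'.fderiv, LinearIsometryEquiv.norm_map, norm_smul, norm_smul, innerSL_apply_norm,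
    norm_inv, norm_norm, inv_mul_cancel₀ (norm_ne_zero_iff.2 hx), mul_one, Real.norm_eq_abs]

lemma spatialLap_radial_s15 {d : ℕ} {g g' g'' : ℝ → ℝ} (hg : ∀ r, HasDerivAt g (g' r) r)
    (hg' : ∀ r, HasDerivAt g' (g'' r) r) {x : Euc d} (hx : x ≠ 0) :
    spatialLap d (fun y => g ‖y‖) x = g'' ‖x‖ + ((d : ℝ) - 1) / ‖x‖ * g' ‖x‖ := by
  have hn : ‖x‖ ≠ 0 := norm_ne_zero_iff.2 hx
  have first : ∀ y : Euc d, y ≠ 0 → ∀ i, fderiv ℝ (fun y => g ‖y‖) y (EuclideanSpace.single i 1)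
      = g' ‖y‖ * (‖y‖⁻¹ * y i) := by
    intro y hy i
    have h' : HasFDerivAt (fun y : Euc d => g ‖y‖) (g' ‖y‖ • ‖y‖⁻¹ • innerSL ℝ y) y :=
      (hg ‖y‖).comp_hasFDerivAt y (hasFDerivAt_norm_of_ne_zero hy)
    rw [h'.fderiv]
    simp [EuclideanSpace.inner_single_right]
  have second : ∀ i, fderiv ℝ (fun y => fderiv ℝ (fun y => g ‖y‖) y (EuclideanSpace.single i 1)) x
      (EuclideanSpace.single i 1)
      = (g'' ‖x‖ / ‖x‖ ^ 2 - g' ‖x‖ / ‖x‖ ^ 3) * x i ^ 2 + g' ‖x‖ / ‖x‖ := by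
    intro i
    have hN := hasFDerivAt_norm_of_ne_zero hx
    have h1 : HasFDerivAt (fun y : Euc d => g' ‖y‖) (g'' ‖x‖ • ‖x‖⁻¹ • innerSL ℝ x) x :=
      (hg' ‖x‖).comp_hasFDerivAt x hN
    have h2 : HasFDerivAt (fun y : Euc d => ‖y‖⁻¹) (-(‖x‖ ^ 2)⁻¹ • ‖x‖⁻¹ • innerSL ℝ x) x :=
      (hasDerivAt_inv hn).comp_hasFDerivAt x hN
    have h3 : HasFDerivAt (fun y : Euc d => y i) (EuclideanSpace.proj i : Euc d →L[ℝ] ℝ) x :=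
      (EuclideanSpace.proj i : Euc d →L[ℝ] ℝ).hasFDerivAt
    have h4 := (h1.mul (h2.mul h3)).congr_of_eventuallyEq (f₁ := fun y : Euc d =>
      fderiv ℝ (fun y => g ‖y‖) y (EuclideanSpace.single i 1)) (by
        filter_upwards [isOpen_ne.mem_nhds hx] with y hy
        simpa using first y hy i)
    rw [h4.fderiv]
    simp [EuclideanSpace.inner_single_right]
    field_simp
    ring
  rw [spatialLap, Finset.sum_congr rfl fun i _ => second i, Finset.sum_add_distrib,
    ← Finset.mul_sum, ← EuclideanSpace.real_norm_sq_eq]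
  simp
  field_simp
  ring

lemma setIntegral_closedBall_radial (m : ℕ) {ρ : ℝ} (hρ : 0 ≤ ρ) (f : ℝ → ℝ) :
    ∫ x in Metric.closedBall (0 : Euc (m + 4)) ρ, f ‖x‖
      = ((m + 4) * volume.real (Metric.ball (0 : Euc (m + 4)) 1))
        * ∫ r in (0 : ℝ)..ρ, r ^ (m + 3) * f r := by
  have h := integral_fun_norm_addHaar (volume : Measure (Euc (m + 4))) (indicator (Iic ρ) f)
  rw [finrank_euclideanSpace_fin] at h
  rw [← integral_indicator Metric.isClosed_closedBall.measurableSet]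
  have e1 : (Metric.closedBall (0 : Euc (m + 4)) ρ).indicator (fun x => f ‖x‖)
      = fun x => indicator (Iic ρ) f ‖x‖ := by
    ext x; simp [indicator]
  have e2 : (fun y : ℝ => y ^ (m + 4 - 1) • indicator (Iic ρ) f y)
      = indicator (Iic ρ) (fun r => r ^ (m + 3) * f r) := by
    ext y; simp [indicator]
  rw [e1, h, e2, setIntegral_indicator measurableSet_Iic, Ioi_inter_Iic,
    intervalIntegral.integral_of_le hρ]
  simp [mul_assoc]

section PartialDerivatives

variable {W : ℝ × ℝ → ℝ}

lemma ContDiff.fderiv_apply_const (hW : ContDiff ℝ (⊤ : ℕ∞) W) (v : ℝ × ℝ) :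
    ContDiff ℝ (⊤ : ℕ∞) fun p => fderiv ℝ W p v :=
  (hW.fderiv_right (m := (⊤ : ℕ∞)) (by simp)).clm_apply contDiff_const

lemma ContDiff.hasDerivAt_fst (hW : ContDiff ℝ (⊤ : ℕ∞) W) (t r : ℝ) :
    HasDerivAt (fun t => W (t, r)) (fderiv ℝ W (t, r) (1, 0)) t :=
  ((hW.differentiable (by simp)) (t, r)).hasFDerivAt.comp_hasDerivAt t
    ((hasDerivAt_id t).prodMk (hasDerivAt_const t r))

lemma ContDiff.hasDerivAt_snd (hW : ContDiff ℝ (⊤ : ℕ∞) W) (t r : ℝ) :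
    HasDerivAt (fun r => W (t, r)) (fderiv ℝ W (t, r) (0, 1)) r :=
  ((hW.differentiable (by simp)) (t, r)).hasFDerivAt.comp_hasDerivAt r
    ((hasDerivAt_const r t).prodMk (hasDerivAt_id r))

lemma ContDiff.fderiv_fderiv_comm (hW : ContDiff ℝ (⊤ : ℕ∞) W) (p v v' : ℝ × ℝ) :
    fderiv ℝ (fun q => fderiv ℝ W q v) p v' = fderiv ℝ (fun q => fderiv ℝ W q v') p v := by
  have hd : DifferentiableAt ℝ (fderiv ℝ W) p :=
    (hW.fderiv_right (m := (⊤ : ℕ∞)) (by simp)).differentiable (by simp) p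
  rw [fderiv_clm_apply hd (differentiableAt_const v),
    fderiv_clm_apply hd (differentiableAt_const v')]
  simpa using (hW.contDiffAt.isSymmSndFDerivAt
    (by simpa using WithTop.coe_le_coe.2 (le_top : (2 : ℕ∞) ≤ ⊤))).eq v' v

end PartialDerivatives

lemma deriv_eq_of_eqOn_Icc {f g : ℝ → ℝ} {T t f' g' : ℝ} (hT : 0 < T) (ht : t ∈ Icc 0 T)
    (hfg : EqOn f g (Icc 0 T)) (hf : HasDerivAt f f' t) (hg : HasDerivAt g g' t) : f' = g' :=
  (uniqueDiffOn_Icc hT t ht).eq_deriv _ hf.hasDerivWithinAt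
    (hg.hasDerivWithinAt.congr hfg (hfg ht))

/-- A radial classical solution on `[0, T]`, `d = m + 4`, is described by a radial profile. -/
lemma exists_isRadialProfile (m : ℕ) {T : ℝ} (hT : 0 < T) {u : ℝ → Euc (m + 4) → ℝ}
    (hu : ContDiff ℝ (⊤ : ℕ∞) (Function.uncurry u))
    (hrad : ∀ t ∈ Icc (0 : ℝ) T, IsRadial (m + 4) (u t))
    (heq : ∀ t ∈ Icc (0 : ℝ) T, ∀ x, timeDeriv2 (m + 4) u t x - spatialLap (m + 4) (u t) x
      + |u t x| ^ ((4 : ℝ) / (((m + 4 : ℕ) : ℝ) - 1)) * u t x = 0) :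
    ∃ w wt wr wtt wtr wrr : ℝ → ℝ → ℝ, IsRadialProfile m T w wt wr wtt wtr wrr ∧
      ∀ t ∈ Icc 0 T, (∀ x, u t x = w t ‖x‖) ∧ (∀ x, timeDeriv (m + 4) u t x = wt t ‖x‖) ∧
        ∀ x, x ≠ 0 → ‖gradient (u t) x‖ = |wr t ‖x‖| := by
  set e : Euc (m + 4) := EuclideanSpace.single 0 1 with he
  have hne : ‖e‖ = 1 := by simp [he]
  set W : ℝ × ℝ → ℝ := fun p => u p.1 (p.2 • e)
  have hW : ContDiff ℝ (⊤ : ℕ∞) W :=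
    hu.comp (contDiff_fst.prodMk (contDiff_snd.smul contDiff_const))
  have hWt := hW.fderiv_apply_const (1, 0)
  have hWr := hW.fderiv_apply_const (0, 1)
  have hform : ∀ t ∈ Icc 0 T, ∀ x, u t x = W (t, ‖x‖) := by
    intro t ht x
    obtain ⟨g, hg⟩ := hrad t ht
    simp [W, hg, norm_smul, hne]
  have htime : ∀ t ∈ Icc 0 T, ∀ x, timeDeriv (m + 4) u t x = fderiv ℝ W (t, ‖x‖) (1, 0) := by
    intro t ht x
    have hd : DifferentiableAt ℝ (fun s => u s x) t :=
      (hu.comp (contDiff_id.prodMk contDiff_const)).differentiable (by simp) t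
    exact deriv_eq_of_eqOn_Icc hT ht (fun s hs => hform s hs x) hd.hasDerivAt
      (hW.hasDerivAt_fst t ‖x‖)
  refine ⟨fun t r => W (t, r), fun t r => fderiv ℝ W (t, r) (1, 0),
    fun t r => fderiv ℝ W (t, r) (0, 1),
    fun t r => fderiv ℝ (fun p => fderiv ℝ W p (1, 0)) (t, r) (1, 0),
    fun t r => fderiv ℝ (fun p => fderiv ℝ W p (1, 0)) (t, r) (0, 1),
    fun t r => fderiv ℝ (fun p => fderiv ℝ W p (0, 1)) (t, r) (0, 1), ?_, ?_⟩
  · refine ⟨hW.continuous, hWt.continuous, hWr.continuous,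
      (hWt.fderiv_apply_const _).continuous, (hWt.fderiv_apply_const _).continuous,
      hW.hasDerivAt_fst, hW.hasDerivAt_snd, hWt.hasDerivAt_fst, hWt.hasDerivAt_snd, ?_,
      hWr.hasDerivAt_snd, ?_⟩
    · intro t r
      rw [hW.fderiv_fderiv_comm]
      exact hWr.hasDerivAt_fst t r
    · intro t ht r hr
      have hnr : ‖r • e‖ = r := by rw [norm_smul, hne, mul_one, Real.norm_of_nonneg hr.le]
      have hx0 : r • e ≠ 0 := by rw [← norm_ne_zero_iff, hnr]; exact hr.ne'
      have h := heq t ht (r • e)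
      rw [show u t = fun x => W (t, ‖x‖) from funext (hform t ht),
        spatialLap_radial_s15 (hW.hasDerivAt_snd t) (hWr.hasDerivAt_snd t) hx0] at h
      have h2 : timeDeriv2 (m + 4) u t (r • e)
          = fderiv ℝ (fun p => fderiv ℝ W p (1, 0)) (t, r) (1, 0) := by
        have : deriv (fun s => u s (r • e)) = fun s => fderiv ℝ W (s, r) (1, 0) :=
          funext fun s => (hW.hasDerivAt_fst s r).deriv
        rw [timeDeriv2, this]
        exact (hWt.hasDerivAt_fst t r).deriv
      rw [h2] at h
      simp only [hnr] at h
      rw [show ((m + 4 : ℕ) : ℝ) - 1 = (m : ℝ) + 3 by push_cast; ring] at h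
      linarith
  · refine fun t ht => ⟨hform t ht, htime t ht, fun x hx => ?_⟩
    rw [show u t = fun x => W (t, ‖x‖) from funext (hform t ht)]
    exact norm_gradient_radial (g := fun r => W (t, r)) hx (hW.hasDerivAt_snd t ‖x‖)

lemma lintegral_cutoff_le {d : ℕ} {χ : Euc d → ℝ} (hχ1 : ∀ x, χ x ≤ 1)
    (hχout : ∀ x : Euc d, 2 ≤ ‖x‖ → χ x = 0) {L : ℝ} (hL : 0 < L) {f : Euc d → ℝ}
    (hf : ∀ x, 0 ≤ f x) (s : Set (Euc d)) :
    ∫⁻ x in s, ENNReal.ofReal (χ (L⁻¹ • x) * f x)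
      ≤ ∫⁻ x in Metric.closedBall 0 (2 * L), ENNReal.ofReal (f x) := by
  rw [← lintegral_indicator Metric.isClosed_closedBall.measurableSet]
  refine (setLIntegral_le_lintegral s _).trans (lintegral_mono fun x => ?_)
  by_cases hx : x ∈ Metric.closedBall (0 : Euc d) (2 * L)
  · rw [indicator_of_mem hx]
    exact ENNReal.ofReal_le_ofReal (mul_le_of_le_one_left (hf x) (hχ1 _))
  · rw [hχout, zero_mul, ENNReal.ofReal_zero]
    · exact zero_le
    · rw [mem_closedBall_zero_iff, not_le] at hx
      rw [norm_smul, norm_inv, Real.norm_of_nonneg hL.le, ← div_eq_inv_mul, le_div_iff₀ hL]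
      exact hx.le

/-- **Local energy decay** (Proposition 5.4). For `d ≥ 4`, a smooth cutoff `χ`
(equal to `1` on the unit ball and `0` outside the ball of radius `2`) and `δ > 0`,
any radial classical solution `u` of the defocusing conformal NLW on `[0, T] × ℝ^d`
satisfies, for every `R > 0`,
`R⁻¹ ∫_0^T ∫_{|x|≤R} χ(x/(δT)) [|∇u|² + (∂ₜu)²] dx dt
  ≤ C (sup_{t∈[0,T]} ‖∇_{t,x}u(t)‖²_{L²(|x|≤2δT)}
      + sup_{t∈[0,T]} (δT)⁻² ‖u(t)‖²_{L²(|x|≤2δT)}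
      + sup_{t∈[0,T]} ‖u(t)‖^{2(d+1)/(d−1)}_{L^{2(d+1)/(d−1)}(|x|≤2δT)})`,
with `C` depending only on `d`, `δ`, and `χ`. -/
theorem local_energy_decay (d : ℕ) (hd : 4 ≤ d)
    (χ : Euc d → ℝ) (hχs : ContDiff ℝ (⊤ : ℕ∞) χ) (hχc : HasCompactSupport χ)
    (hχ0 : ∀ x, 0 ≤ χ x) (hχ1 : ∀ x, χ x ≤ 1)
    (hχin : ∀ x : Euc d, ‖x‖ ≤ 1 → χ x = 1) (hχout : ∀ x : Euc d, 2 ≤ ‖x‖ → χ x = 0)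
    (δ : ℝ) (hδ : 0 < δ) :
    ∃ C : ℝ, 0 < C ∧
      ∀ (T : ℝ), 0 < T → ∀ u : ℝ → Euc d → ℝ,
        ContDiff ℝ (⊤ : ℕ∞) (Function.uncurry u) →
        (∀ t, HasCompactSupport (u t)) →
        (∀ t, HasCompactSupport (fun x => timeDeriv d u t x)) →
        (∀ t ∈ Icc (0 : ℝ) T, IsRadial d (u t)) →
        (∀ t ∈ Icc (0 : ℝ) T, ∀ x, timeDeriv2 d u t x - spatialLap d (u t) x
            + |u t x| ^ ((4 : ℝ) / ((d : ℝ) - 1)) * u t x = 0) →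
        ∀ R : ℝ, 0 < R →
        ENNReal.ofReal R⁻¹ *
            (∫⁻ t in Icc (0 : ℝ) T, ∫⁻ x in Metric.closedBall (0 : Euc d) R,
              ENNReal.ofReal (χ ((δ * T)⁻¹ • x) *
                (‖gradient (u t) x‖ ^ 2 + (timeDeriv d u t x) ^ 2))) ≤
          ENNReal.ofReal C *
            ((⨆ t ∈ Icc (0 : ℝ) T, ENNReal.ofReal
                (∫ x in Metric.closedBall (0 : Euc d) (2 * δ * T),
                  (‖gradient (u t) x‖ ^ 2 + (timeDeriv d u t x) ^ 2))) +
              (⨆ t ∈ Icc (0 : ℝ) T, ENNReal.ofReal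
                (((δ * T) ^ 2)⁻¹ *
                  ∫ x in Metric.closedBall (0 : Euc d) (2 * δ * T), (u t x) ^ 2)) +
              (⨆ t ∈ Icc (0 : ℝ) T, ENNReal.ofReal
                (∫ x in Metric.closedBall (0 : Euc d) (2 * δ * T),
                  |u t x| ^ (2 * ((d : ℝ) + 1) / ((d : ℝ) - 1))))) := by
  obtain ⟨m, rfl⟩ : ∃ m, d = m + 4 := ⟨d - 4, by lia⟩
  set κ : ℝ := 48 * ((δ⁻¹ + 2) * (1 + ((m : ℝ) + 3) ^ 2 / 2)) with hκ
  have hκ0 : 0 < κ := by positivity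
  have hδ' : 0 < δ⁻¹ := by positivity
  refine ⟨κ + δ⁻¹, by positivity, ?_⟩
  intro T hT u hu _ _ hrad heq R hR
  have hL : 0 < δ * T := by positivity
  have h2L : 0 ≤ 2 * (δ * T) := by positivity
  obtain ⟨w, wt, wr, wtt, wtr, wrr, hw, hform⟩ := exists_isRadialProfile m hT hu hrad heq
  rw [mul_assoc 2 δ T]
  generalize hLdef : δ * T = L at *
  have hTL : T / L = δ⁻¹ := by rw [← hLdef]; field_simp
  set ω : ℝ := (m + 4) * volume.real (Metric.ball (0 : Euc (m + 4)) 1) with hω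
  have hω0 : 0 < ω := by
    have : 0 < volume.real (Metric.ball (0 : Euc (m + 4)) 1) :=
      ENNReal.toReal_pos (Metric.measure_ball_pos _ _ one_pos).ne' measure_ball_lt_top.ne
    positivity
  have := hw.cont_w; have := hw.cont_wr; have := hw.cont_wt
  have c1 : ∀ t, Continuous fun r => wr t r := fun t => hw.cont_wr.comp (Continuous.prodMk_right t)
  have c2 : ∀ t, Continuous fun r => wt t r := fun t => hw.cont_wt.comp (Continuous.prodMk_right t)
  set E : ℝ → Euc (m + 4) → ℝ := fun t x =>
    ‖gradient (u t) x‖ ^ 2 + timeDeriv (m + 4) u t x ^ 2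
  have hE0 : ∀ t x, 0 ≤ E t x := fun t x => by positivity
  have hEae : ∀ t ∈ Icc 0 T, ∀ᵐ x, E t x = wr t ‖x‖ ^ 2 + wt t ‖x‖ ^ 2 := by
    intro t ht
    filter_upwards [compl_mem_ae_iff.2 (measure_singleton (0 : Euc (m + 4)))] with x hx
    simp only [E, (hform t ht).2.1, (hform t ht).2.2 x hx, sq_abs]
  have hEint : ∀ t ∈ Icc 0 T, ∀ ρ, 0 ≤ ρ → ∫ x in Metric.closedBall (0 : Euc (m + 4)) ρ, E t x
      = ω * ∫ r in (0 : ℝ)..ρ, r ^ (m + 3) * (wr t r ^ 2 + wt t r ^ 2) := by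
    intro t ht ρ hρ
    rw [integral_congr_ae (ae_restrict_of_ae (hEae t ht))]
    exact setIntegral_closedBall_radial m hρ fun r => wr t r ^ 2 + wt t r ^ 2
  have hElint : ∀ t ∈ Icc 0 T, ∀ ρ,
      ∫⁻ x in Metric.closedBall (0 : Euc (m + 4)) ρ, ENNReal.ofReal (E t x)
      = ENNReal.ofReal (∫ x in Metric.closedBall (0 : Euc (m + 4)) ρ, E t x) := by
    intro t ht ρ
    refine (ofReal_integral_eq_lintegral_ofReal ?_ (Filter.Eventually.of_forall (hE0 t))).symm
    refine Integrable.congr (f := fun x => wr t ‖x‖ ^ 2 + wt t ‖x‖ ^ 2) ?_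
      ((ae_restrict_of_ae (hEae t ht)).mono fun x hx => hx.symm)
    have : Continuous fun x : Euc (m + 4) => wr t ‖x‖ ^ 2 + wt t ‖x‖ ^ 2 :=
      (((c1 t).comp continuous_norm).pow 2).add (((c2 t).comp continuous_norm).pow 2)
    exact this.continuousOn.integrableOn_compact (isCompact_closedBall _ _)
  set S₁ := ⨆ t ∈ Icc (0 : ℝ) T, ENNReal.ofReal
    (∫ x in Metric.closedBall (0 : Euc (m + 4)) (2 * L), E t x)
  set S₂ := ⨆ t ∈ Icc (0 : ℝ) T, ENNReal.ofReal ((L ^ 2)⁻¹ *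
    ∫ x in Metric.closedBall (0 : Euc (m + 4)) (2 * L), u t x ^ 2)
  have hS₁ : ∀ t ∈ Icc (0 : ℝ) T, ENNReal.ofReal
    (∫ x in Metric.closedBall (0 : Euc (m + 4)) (2 * L), E t x) ≤ S₁ := fun t ht =>
      le_iSup₂ (f := fun t (_ : t ∈ Icc (0 : ℝ) T) => ENNReal.ofReal
        (∫ x in Metric.closedBall (0 : Euc (m + 4)) (2 * L), E t x)) t ht
  have hS₂ : ∀ t ∈ Icc (0 : ℝ) T, ENNReal.ofReal ((L ^ 2)⁻¹ *
    ∫ x in Metric.closedBall (0 : Euc (m + 4)) (2 * L), u t x ^ 2) ≤ S₂ := fun t ht =>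
      le_iSup₂ (f := fun t (_ : t ∈ Icc (0 : ℝ) T) => ENNReal.ofReal ((L ^ 2)⁻¹ *
        ∫ x in Metric.closedBall (0 : Euc (m + 4)) (2 * L), u t x ^ 2)) t ht
  refine le_trans ?_ (mul_le_mul_right (le_self_add : S₁ + S₂ ≤ _) _)
  rcases eq_or_ne (S₁ + S₂) ⊤ with htop | htop
  · rw [htop, ENNReal.mul_top (by simpa using by positivity)]
    exact le_top
  rcases le_or_gt R L with hRL | hRL
  · obtain ⟨h₁, h₂⟩ := ENNReal.add_ne_top.1 htop
    have hH : ∀ t ∈ Icc 0 T,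
        ∫ r in (0 : ℝ)..2 * L, kineticDensity m r (w t r) (wr t r) (wt t r)
          ≤ (1 + ((m : ℝ) + 3) ^ 2 / 2) * ((S₁ + S₂).toReal / ω) := by
      intro t ht
      have i₁ := (ENNReal.ofReal_le_iff_le_toReal h₁).1 (hS₁ t ht)
      have i₂ := (ENNReal.ofReal_le_iff_le_toReal h₂).1 (hS₂ t ht)
      rw [hEint t ht _ h2L] at i₁
      simp only [(hform t ht).1] at i₂
      rw [setIntegral_closedBall_radial m h2L fun r => w t r ^ 2, ← hω] at i₂
      refine (integral_kineticDensity_le m hL (hw.hasDerivAt_radius t) (c1 t) (c2 t)).trans ?_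
      refine mul_le_mul_of_nonneg_left ?_ (by positivity)
      rw [ENNReal.toReal_add h₁ h₂, le_div_iff₀ hω0]
      linarith
    have hmain := hw.integral_energy_le_of_kineticDensity_le hT.le hR hRL hH
    rw [hTL] at hmain
    have hec : Continuous fun t => ∫ r in (0 : ℝ)..R, r ^ (m + 3) * (wr t r ^ 2 + wt t r ^ 2) :=
      intervalIntegral.continuous_parametric_intervalIntegral_of_continuous'
        (f := fun t r => r ^ (m + 3) * (wr t r ^ 2 + wt t r ^ 2))
        (by unfold Function.uncurry; fun_prop) 0 R
    have hωc : Continuous fun t =>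
        ω * ∫ r in (0 : ℝ)..R, r ^ (m + 3) * (wr t r ^ 2 + wt t r ^ 2) := continuous_const.mul hec
    have hinner : ∀ t ∈ Icc 0 T, ∫⁻ x in Metric.closedBall (0 : Euc (m + 4)) R,
        ENNReal.ofReal (χ (L⁻¹ • x) * E t x)
        ≤ ENNReal.ofReal (ω * ∫ r in (0 : ℝ)..R, r ^ (m + 3) * (wr t r ^ 2 + wt t r ^ 2)) := by
      intro t ht
      rw [← hEint t ht R hR.le, ← hElint t ht R]
      exact lintegral_mono fun x =>
        ENNReal.ofReal_le_ofReal (mul_le_of_le_one_left (hE0 t x) (hχ1 _))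
    have hnn : ∀ t, 0 ≤ ω * ∫ r in (0 : ℝ)..R, r ^ (m + 3) * (wr t r ^ 2 + wt t r ^ 2) := fun t =>
      mul_nonneg hω0.le (intervalIntegral.integral_nonneg hR.le fun r hr =>
        mul_nonneg (pow_nonneg hr.1 _) (by positivity))
    calc _ ≤ ENNReal.ofReal R⁻¹ * ∫⁻ t in Icc 0 T, ENNReal.ofReal
            (ω * ∫ r in (0 : ℝ)..R, r ^ (m + 3) * (wr t r ^ 2 + wt t r ^ 2)) := by
          gcongr 1
          exact setLIntegral_mono' measurableSet_Icc hinner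
      _ = ENNReal.ofReal (R⁻¹ * (ω * ∫ t in (0 : ℝ)..T, ∫ r in (0 : ℝ)..R,
            r ^ (m + 3) * (wr t r ^ 2 + wt t r ^ 2))) := by
          rw [← ofReal_integral_eq_lintegral_ofReal
            (hωc.continuousOn.integrableOn_compact isCompact_Icc)
            (Filter.Eventually.of_forall hnn), ← ENNReal.ofReal_mul (by positivity),
            integral_Icc_eq_integral_Ioc, ← intervalIntegral.integral_of_le hT.le,
            intervalIntegral.integral_const_mul]
      _ ≤ ENNReal.ofReal (κ * (S₁ + S₂).toReal) := by
          refine ENNReal.ofReal_le_ofReal ?_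
          rw [inv_mul_le_iff₀ hR]
          refine (mul_le_mul_of_nonneg_left hmain hω0.le).trans_eq ?_
          rw [hκ]
          field_simp
      _ = ENNReal.ofReal κ * (S₁ + S₂) := by
          rw [ENNReal.ofReal_mul hκ0.le, ENNReal.ofReal_toReal htop]
      _ ≤ ENNReal.ofReal (κ + δ⁻¹) * (S₁ + S₂) := by
          gcongr
          linarith
  · calc _ ≤ ENNReal.ofReal R⁻¹ * ∫⁻ _t in Icc 0 T, S₁ := by
          gcongr 1
          refine setLIntegral_mono' measurableSet_Icc fun t ht => ?_
          refine (lintegral_cutoff_le hχ1 hχout hL (hE0 t) _).trans ?_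
          rw [hElint t ht]
          exact hS₁ t ht
      _ = ENNReal.ofReal (R⁻¹ * T) * S₁ := by
          rw [setLIntegral_const, Real.volume_Icc, sub_zero, mul_comm S₁, ← mul_assoc,
            ← ENNReal.ofReal_mul (by positivity)]
      _ ≤ ENNReal.ofReal (κ + δ⁻¹) * (S₁ + S₂) := by
          gcongr
          · have : R⁻¹ * T ≤ δ⁻¹ := by
              rw [← hTL, ← div_eq_inv_mul]
              gcongr
            linarith
          · exact le_self_add
end
end
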